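/- The number m*(λ,μ,ν) of 3-dimensional binary matrices with 1-marginals λ, μ, ν equals Σ_{α,β,γ} K_{αλ} K_{βμ} K_{γν} · k(α,β,γ'), where γ' is the conjugate of γ and k denotes the Kronecker coefficient. -/

import Mathlib

open Finset Equiv
open scoped Classical

noncomputable section

/-- Value at `g` of the permutation character of `S_n` induced from the trivial character of
the Young subgroup of the composition `c`: the number of colorings of `Fin n` with fiber
sizes given by `c` that are fixed by `g`. -/
def permChar (n : ℕ) (c : ℕ → ℕ) (g : Perm (Fin n)) : ℚ :=
  Nat.card {f : Fin n → ℕ // (∀ k, Nat.card {x : Fin n // f x = k} = c k) ∧ ∀ x, f (g x) = f x}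

/-- Inner product of class functions (real-valued characters) of `S_n`. -/
def innerChar (n : ℕ) (χ ψ : Perm (Fin n) → ℚ) : ℚ :=
  (∑ g : Perm (Fin n), χ g * ψ g) / (n.factorial : ℚ)

/-- The trivial character `χ^{(n)}` of `S_n`. -/
def trivChar (n : ℕ) : Perm (Fin n) → ℚ := fun _ => 1

/-- The sign character `χ^{(1^n)}` of `S_n`. -/
def signChar (n : ℕ) : Perm (Fin n) → ℚ := fun g => ((Perm.sign g : ℤ) : ℚ)

/-- Permutation character for an integer vector: zero if some entry is negative. -/
def permCharZ (n : ℕ) (c : ℕ → ℤ) (g : Perm (Fin n)) : ℚ :=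
  if ∀ k, 0 ≤ c k then permChar n (fun k => (c k).toNat) g else 0

/-- The irreducible character `χ^a` of `S_n` indexed by the partition `a`, given by the
Jacobi–Trudi determinantal formula `χ^a = ∑_σ sgn(σ) φ^{(a_i - i + σ(i))_i}`. -/
def irrChar (n : ℕ) (a : ℕ → ℕ) (g : Perm (Fin n)) : ℚ :=
  ∑ σ : Perm (Fin n), ((Perm.sign σ : ℤ) : ℚ) *
    permCharZ n (fun i => if h : i < n then (a i : ℤ) - i + ((σ ⟨i, h⟩ : Fin n) : ℕ) else 0) g

/-- Kronecker coefficient `k(a,b,c) = ⟨χ^a ⊗ χ^b, χ^c⟩`. -/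
def kron (n : ℕ) (a b c : ℕ → ℕ) : ℚ :=
  innerChar n (fun g => irrChar n a g * irrChar n b g) (irrChar n c)

/-- Extend a vector indexed by `Fin p` to `ℕ` by zeros. -/
def extc {p : ℕ} (l : Fin p → ℕ) : ℕ → ℕ := fun i => if h : i < p then l ⟨i, h⟩ else 0

/-- Dominance order: `a ⊵ b`. -/
def Dominates (a b : ℕ → ℕ) : Prop :=
  ∀ k, ∑ i ∈ Finset.range k, b i ≤ ∑ i ∈ Finset.range k, a i

/-- Conjugate (transpose) of a partition with at most `n` parts. -/
def conjFun (n : ℕ) (a : ℕ → ℕ) : ℕ → ℕ :=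
  fun j => ((Finset.range n).filter (fun i => j < a i)).card

/-- `a` is a partition of `n` (weakly decreasing, supported on the first `n` parts). -/
def IsPartitionFun (n : ℕ) (a : ℕ → ℕ) : Prop :=
  (∀ i j, i ≤ j → a j ≤ a i) ∧ (∀ i, n ≤ i → a i = 0) ∧ ∑ i ∈ Finset.range n, a i = n

/-- The weakly decreasing sequence of parts of `P : Nat.Partition n`. -/
def pf {n : ℕ} (P : n.Partition) : ℕ → ℕ :=
  fun i => ((P.parts.sort (· ≤ ·)).reverse).getD i 0

/-- The parts of `P : Nat.Partition n` as a vector of length `n`. -/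
def pfin {n : ℕ} (P : n.Partition) : Fin n → ℕ := fun k => pf P k

/-- Number of cells of the skew shape `a/b` where the filling `T` has entry `k`. -/
def skewContent (a b : ℕ → ℕ) (T : ℕ → ℕ → ℕ) (k : ℕ) : ℕ :=
  Nat.card {p : ℕ × ℕ // b p.1 ≤ p.2 ∧ p.2 < a p.1 ∧ T p.1 p.2 = k}

/-- Number of cells of the skew shape `a/b`. -/
def skewSize (a b : ℕ → ℕ) : ℕ :=
  Nat.card {p : ℕ × ℕ // b p.1 ≤ p.2 ∧ p.2 < a p.1}

/-- `T` is a semistandard filling of the shape `a` (zero outside, rows weakly increasing,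
columns strictly increasing). -/
def IsSSYT (a : ℕ → ℕ) (T : ℕ → ℕ → ℕ) : Prop :=
  (∀ i j, a i ≤ j → T i j = 0) ∧
  (∀ i j₁ j₂, j₁ ≤ j₂ → j₂ < a i → T i j₁ ≤ T i j₂) ∧
  (∀ i₁ i₂ j, i₁ < i₂ → j < a i₂ → T i₁ j < T i₂ j)

/-- The Kostka number: the number of semistandard Young tableaux of shape `a`
and content `c`. -/
def kostka (a c : ℕ → ℕ) : ℕ :=
  Nat.card {T : ℕ → ℕ → ℕ // IsSSYT a T ∧ ∀ k, skewContent a (fun _ => 0) T k = c k}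

/-- Number of entries equal to `k` in the prefix of the (right-to-left, top-to-bottom)
reading word of `T` ending at position `(i,j)`. -/
def lrCount (a b : ℕ → ℕ) (T : ℕ → ℕ → ℕ) (i j k : ℕ) : ℕ :=
  Nat.card {p : ℕ × ℕ //
    (p.1 < i ∨ (p.1 = i ∧ j ≤ p.2)) ∧ b p.1 ≤ p.2 ∧ p.2 < a p.1 ∧ T p.1 p.2 = k}

/-- `T` is a Littlewood–Richardson skew tableau of shape `a/b`: semistandard and its
reverse reading word is a lattice word. -/
def IsLR (a b : ℕ → ℕ) (T : ℕ → ℕ → ℕ) : Prop :=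
  (∀ i j, ¬(b i ≤ j ∧ j < a i) → T i j = 0) ∧
  (∀ i j₁ j₂, b i ≤ j₁ → j₁ ≤ j₂ → j₂ < a i → T i j₁ ≤ T i j₂) ∧
  (∀ i₁ i₂ j, i₁ < i₂ → b i₁ ≤ j → j < a i₁ → b i₂ ≤ j → j < a i₂ → T i₁ j < T i₂ j) ∧
  (∀ i j k, lrCount a b T i j (k + 1) ≤ lrCount a b T i j k)

/-- A Littlewood–Richardson multitableau of shape `α` with `r` parts: a chain of
partitions `0 = α(0) ⊆ α(1) ⊆ ⋯ ⊆ α(r) = α` together with Littlewood–Richardson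
fillings of the successive skew shapes. -/
structure LRMultiF (r : ℕ) (α : ℕ → ℕ) where
  chain : Fin (r + 1) → ℕ → ℕ
  antitone : ∀ k i j, i ≤ j → chain k j ≤ chain k i
  zero : ∀ i, chain 0 i = 0
  last : ∀ i, chain (Fin.last r) i = α i
  mono : ∀ (k : Fin r) (i : ℕ), chain k.castSucc i ≤ chain k.succ i
  T : Fin r → ℕ → ℕ → ℕ
  lr : ∀ k : Fin r, IsLR (chain k.succ) (chain k.castSucc) (T k)

/-- Content of the `k`-th tableau of a Littlewood–Richardson multitableau. -/
def LRMultiF.cont {r : ℕ} {α : ℕ → ℕ} (M : LRMultiF r α) (k : Fin r) : ℕ → ℕ :=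
  skewContent (M.chain k.succ) (M.chain k.castSucc) (M.T k)

/-- Size of the `k`-th tableau of a Littlewood–Richardson multitableau. -/
def LRMultiF.size {r : ℕ} {α : ℕ → ℕ} (M : LRMultiF r α) (k : Fin r) : ℕ :=
  skewSize (M.chain k.succ) (M.chain k.castSucc)

/-- `LR(α,β;ν)`: pairs of Littlewood–Richardson multitableaux of shapes `α`, `β`,
type `ν`, with equal contents. -/
def LRPairs (r : ℕ) (α β : ℕ → ℕ) (ν : Fin r → ℕ) :=
  {TS : LRMultiF r α × LRMultiF r β //
    (∀ k, TS.1.size k = ν k) ∧ (∀ k, TS.2.size k = ν k) ∧ ∀ k, TS.1.cont k = TS.2.cont k}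

/-- `LR*(α,β;ν)`: pairs of Littlewood–Richardson multitableaux of shapes `α`, `β`,
type `ν`, with termwise conjugate contents. -/
def LRPairsStar (n r : ℕ) (α β : ℕ → ℕ) (ν : Fin r → ℕ) :=
  {TS : LRMultiF r α × LRMultiF r β //
    (∀ k, TS.1.size k = ν k) ∧ (∀ k, TS.2.size k = ν k) ∧
      ∀ k m, TS.2.cont k m = conjFun n (TS.1.cont k) m}

/-- `lr(α,β;ν)`. -/
def lrNum (r : ℕ) (α β : ℕ → ℕ) (ν : Fin r → ℕ) : ℕ := Nat.card (LRPairs r α β ν)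

/-- `lr*(α,β;ν)`. -/
def lrStarNum (n r : ℕ) (α β : ℕ → ℕ) (ν : Fin r → ℕ) : ℕ :=
  Nat.card (LRPairsStar n r α β ν)

/-- A semistandard Young tableau (of arbitrary partition shape). -/
structure SSYTP where
  shape : ℕ → ℕ
  T : ℕ → ℕ → ℕ
  antitone : ∀ i j, i ≤ j → shape j ≤ shape i
  finite : ∃ N, ∀ i, N ≤ i → shape i = 0
  ssyt : IsSSYT shape T

/-- Content of a semistandard Young tableau. -/
def SSYTP.cont (P : SSYTP) : ℕ → ℕ := skewContent P.shape (fun _ => 0) P.T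

/-- The multiset of entries of a matrix. -/
def entriesM {p q : ℕ} (A : Fin p → Fin q → ℕ) : Multiset ℕ :=
  (Finset.univ : Finset (Fin p × Fin q)).val.map (fun ij => A ij.1 ij.2)

/-- The π-sequence of `A` is the partition `ν` (the weakly decreasing rearrangement of
the entries of `A` is `ν`). -/
def HasPiSeq {p q : ℕ} (A : Fin p → Fin q → ℕ) {n : ℕ} (ν : n.Partition) : Prop :=
  (entriesM A).filter (· ≠ 0) = ν.parts

end

namespace BinaryMatrixCount

/-! ### Alternants -/

/-- The staircase vector `(N - 1, N - 2, …, 0)`. -/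
def delta (N : ℕ) (i : Fin N) : ℤ := N - 1 - i

/-- Coefficient of `x^β` in the product of the Vandermonde determinant with the formal series
whose coefficients are given by `F`. -/
def alt (N : ℕ) (F : (Fin N → ℤ) → ℚ) (β : Fin N → ℤ) : ℚ :=
  ∑ σ : Perm (Fin N), ((Perm.sign σ : ℤ) : ℚ) * F (fun i => β i - delta N (σ i))

/-- Invariance under permutations of the variables. -/
def IsSym {N : ℕ} (F : (Fin N → ℤ) → ℚ) : Prop := ∀ (τ : Perm (Fin N)) c, F (c ∘ τ) = F c

/-- The coefficient family `F` is supported on exponents of a homogeneous polynomial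
of degree `d`. -/
def IsHomog {N : ℕ} (F : (Fin N → ℤ) → ℚ) (d : ℤ) : Prop :=
  ∀ c, F c ≠ 0 → (∀ i, 0 ≤ c i) ∧ ∑ i, c i = d

theorem delta_nonneg {N : ℕ} (i : Fin N) : 0 ≤ delta N i := by
  unfold delta; omega

theorem delta_lt {N : ℕ} (i : Fin N) : delta N i < N := by
  unfold delta; omega

theorem sum_delta_comp {N : ℕ} (σ : Perm (Fin N)) : ∑ i, delta N (σ i) = ∑ i, delta N i :=
  Equiv.sum_comp σ (delta N)

theorem alt_comp {N : ℕ} {F : (Fin N → ℤ) → ℚ} (hF : IsSym F) (τ : Perm (Fin N))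
    (β : Fin N → ℤ) : alt N F (β ∘ τ) = ((Perm.sign τ : ℤ) : ℚ) * alt N F β := by
  unfold alt
  rw [Finset.mul_sum, ← Equiv.sum_comp (Equiv.mulRight τ)]
  refine Finset.sum_congr rfl fun σ _ => ?_
  have : (fun i => (β ∘ τ) i - delta N ((Equiv.mulRight τ σ) i))
      = (fun i => β i - delta N (σ i)) ∘ τ := by
    funext i; simp
  rw [this, hF]
  simp only [Equiv.coe_mulRight, map_mul, Units.val_mul, Int.cast_mul]
  ring

theorem alt_swap {N : ℕ} {F : (Fin N → ℤ) → ℚ} (hF : IsSym F) {i j : Fin N} (hij : i ≠ j)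
    (β : Fin N → ℤ) : alt N F (β ∘ Equiv.swap i j) = - alt N F β := by
  rw [alt_comp hF, Perm.sign_swap hij]; simp

theorem exists_of_alt_ne_zero {N : ℕ} {F : (Fin N → ℤ) → ℚ} {β : Fin N → ℤ}
    (h : alt N F β ≠ 0) : ∃ σ : Perm (Fin N), F (fun i => β i - delta N (σ i)) ≠ 0 := by
  by_contra! hc
  exact h (Finset.sum_eq_zero fun σ _ => by rw [hc σ, mul_zero])

theorem alt_support {N : ℕ} {F : (Fin N → ℤ) → ℚ} {d : ℤ} (hF : IsHomog F d) {β : Fin N → ℤ}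
    (h : alt N F β ≠ 0) :
    (∀ i, 0 ≤ β i) ∧ (∀ i, β i < d + N) ∧ ∑ i, β i = d + ∑ i, delta N i := by
  obtain ⟨σ, hσ⟩ := exists_of_alt_ne_zero h
  obtain ⟨h0, h1⟩ := hF _ hσ
  refine ⟨fun i => ?_, fun i => ?_, ?_⟩
  · have := h0 i
    have := delta_nonneg (σ i)
    omega
  · have := Finset.single_le_sum (fun j _ => h0 j) (Finset.mem_univ i)
    have := delta_lt (σ i)
    omega
  · rw [Finset.sum_sub_distrib, sum_delta_comp] at h1
    omega

/-- The Vandermonde determinant with decreasing exponents. -/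
theorem sum_sign_mul_prod_pow {R : Type*} [CommRing R] (N : ℕ) (v : Fin N → R) :
    ∑ σ : Perm (Fin N), ((Perm.sign σ : ℤ) : R) * ∏ i, v i ^ (N - 1 - (σ i : ℕ))
      = ∏ i, ∏ j ∈ Finset.Ioi i, (v i - v j) := by
  have h1 : ∑ σ : Perm (Fin N), ((Perm.sign σ : ℤ) : R) * ∏ i, v i ^ (N - 1 - (σ i : ℕ))
      = (Matrix.vandermonde fun i => v (Fin.rev i)).det := by
    rw [← Matrix.det_submatrix_equiv_self Fin.revPerm, ← Matrix.det_transpose, Matrix.det_apply']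
    refine Finset.sum_congr rfl fun σ _ => ?_
    congr 1
    refine Finset.prod_congr rfl fun i _ => ?_
    simp only [Matrix.transpose_apply, Matrix.submatrix_apply, Matrix.vandermonde_apply,
      Fin.revPerm_apply, Fin.rev_rev]
    congr 1
    rw [Fin.val_rev]; omega
  rw [h1, Matrix.det_vandermonde]
  simp only [Finset.prod_sigma']
  refine Finset.prod_nbij' (fun x => ⟨Fin.rev x.2, Fin.rev x.1⟩)
    (fun x => ⟨Fin.rev x.2, Fin.rev x.1⟩) ?_ ?_ ?_ ?_ ?_
  · rintro ⟨i, j⟩ h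
    simp only [Finset.mem_sigma, Finset.mem_univ, Finset.mem_Ioi, true_and] at h ⊢
    exact Fin.rev_lt_rev.2 h
  · rintro ⟨i, j⟩ h
    simp only [Finset.mem_sigma, Finset.mem_univ, Finset.mem_Ioi, true_and] at h ⊢
    exact Fin.rev_lt_rev.2 h
  · rintro ⟨i, j⟩ h; simp
  · rintro ⟨i, j⟩ h; simp
  · rintro ⟨i, j⟩ h; simp

/-- Splitting off the last variable in the Vandermonde product. -/
theorem prod_Ioi_castSucc {R : Type*} [CommRing R] (N : ℕ) (v : Fin (N + 1) → R) :
    ∏ i, ∏ j ∈ Finset.Ioi i, (v i - v j)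
      = (∏ i : Fin N, ∏ j ∈ Finset.Ioi i, (v i.castSucc - v j.castSucc)) *
          ∏ i : Fin N, (v i.castSucc - v (Fin.last N)) := by
  have key : ∀ (n : ℕ) (w : Fin n → R), ∏ i, ∏ j ∈ Finset.Ioi i, (w i - w j)
      = ∏ i, ∏ j, if i < j then w i - w j else 1 := by
    intro n w
    refine Finset.prod_congr rfl fun i _ => ?_
    rw [← Finset.prod_filter]
    congr 1; ext j; simp
  rw [key, key N (fun i => v i.castSucc), Fin.prod_univ_castSucc]
  simp only [Fin.prod_univ_castSucc (n := N), Finset.prod_mul_distrib]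
  have h2 : ∀ j : Fin N, ¬ (Fin.last N < j.castSucc) := fun j => by
    simpa using (Fin.castSucc_lt_last j).le
  simp [h2, Fin.castSucc_lt_last]

/-! ### Action of Laurent polynomials on coefficient families -/

/-- Multiplication by a Laurent polynomial, as an operator on coefficient families. -/
noncomputable def act (G : Type*) [AddCommGroup G] :
    AddMonoidAlgebra ℚ G →ₐ[ℚ] Module.End ℚ (G → ℚ) :=
  AddMonoidAlgebra.lift ℚ _ G
    { toFun := fun v => LinearMap.funLeft ℚ ℚ (fun β => β - v.toAdd)
      map_one' := by ext; simp [LinearMap.funLeft_apply]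
      map_mul' := fun v w => by
        refine LinearMap.ext fun f => funext fun x => ?_
        simp only [LinearMap.funLeft_apply, Module.End.mul_apply, toAdd_mul]
        congr 1
        abel }

theorem act_single {G : Type*} [AddCommGroup G] (v : G) (F : G → ℚ) (β : G) :
    act G (AddMonoidAlgebra.single v 1) F β = F (β - v) := by
  simp [act, LinearMap.funLeft_apply]

/-- The Laurent monomial `x_i`. -/
noncomputable def X {N : ℕ} (i : Fin N) : AddMonoidAlgebra ℚ (Fin N → ℤ) :=
  AddMonoidAlgebra.single (Pi.single i 1) 1

theorem act_X_sub_X {N : ℕ} (i j : Fin N) (F : (Fin N → ℤ) → ℚ) (β : Fin N → ℤ) :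
    act _ (X i - X j) F β = F (β - Pi.single i 1) - F (β - Pi.single j 1) := by
  rw [map_sub, LinearMap.sub_apply, Pi.sub_apply, X, X, act_single, act_single]

theorem prod_X_pow {N M : ℕ} (f : Fin M → Fin N) (e : Fin M → ℕ) :
    ∏ i, (X (f i)) ^ e i
      = AddMonoidAlgebra.single (∑ i, Pi.single (f i) (e i : ℤ)) (1 : ℚ) := by
  have : ∀ s : Finset (Fin M), ∏ i ∈ s, (X (f i)) ^ e i
      = AddMonoidAlgebra.single (∑ i ∈ s, Pi.single (f i) (e i : ℤ)) (1 : ℚ) := by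
    intro s
    induction s using Finset.induction_on with
    | empty => simp [AddMonoidAlgebra.one_def]
    | insert a s ha ih =>
      rw [Finset.prod_insert ha, Finset.sum_insert ha, ih, X, AddMonoidAlgebra.single_pow,
        AddMonoidAlgebra.single_mul_single]
      congr 1
      · congr 1
        rw [← Pi.single_smul]; simp
      · simp
  exact this _

theorem act_vandermonde {N M : ℕ} (f : Fin M → Fin N) (F : (Fin N → ℤ) → ℚ) (β : Fin N → ℤ) :
    act _ (∏ i, ∏ j ∈ Finset.Ioi i, (X (f i) - X (f j))) F β
      = ∑ σ : Perm (Fin M), ((Perm.sign σ : ℤ) : ℚ) *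
          F (β - ∑ i, Pi.single (f i) (delta M (σ i))) := by
  rw [← sum_sign_mul_prod_pow M (fun i => X (f i)), map_sum, LinearMap.sum_apply,
    Finset.sum_apply]
  refine Finset.sum_congr rfl fun σ _ => ?_
  rw [prod_X_pow, map_mul, map_intCast]
  have : ((Perm.sign σ : ℤ) : Module.End ℚ ((Fin N → ℤ) → ℚ))
      = algebraMap ℚ _ ((Perm.sign σ : ℤ) : ℚ) := by simp
  rw [this, Module.algebraMap_end_eq_smul_id]
  simp only [Module.End.mul_apply, LinearMap.smul_apply, LinearMap.id_apply, Pi.smul_apply,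
    act_single, smul_eq_mul]
  congr 4
  funext i
  congr 1
  unfold delta; omega

theorem act_vandermonde_eq_alt {N : ℕ} (F : (Fin N → ℤ) → ℚ) :
    act _ (∏ i, ∏ j ∈ Finset.Ioi i, (X i - X j)) F = alt N F := by
  funext β
  have h := act_vandermonde (id : Fin N → Fin N) F β
  simp only [id] at h
  rw [h, alt]
  refine Finset.sum_congr rfl fun σ _ => ?_
  congr 2
  funext i
  simp [Finset.sum_apply, Pi.single_apply]

theorem act_vandermonde_castSucc {N : ℕ} (F : (Fin (N + 1) → ℤ) → ℚ) (β : Fin N → ℤ) (k : ℤ) :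
    act _ (∏ i : Fin N, ∏ j ∈ Finset.Ioi i, (X i.castSucc - X j.castSucc)) F
        (Fin.snoc (α := fun _ => ℤ) β k)
      = alt N (fun c => F (Fin.snoc (α := fun _ => ℤ) c k)) β := by
  rw [act_vandermonde Fin.castSucc, alt]
  refine Finset.sum_congr rfl fun σ _ => ?_
  congr 2
  funext i
  refine Fin.lastCases ?_ (fun i => ?_) i
  · simp [Finset.sum_apply, (Fin.castSucc_lt_last _).ne']
  · simp [Finset.sum_apply, Pi.single_apply]

/-! ### The branching rule -/

theorem act_snoc {N : ℕ} (G : (Fin (N + 1) → ℤ) → ℚ) (C : ℤ) (γ : Fin N → ℤ) (i : Fin N) :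
    act _ (X i.castSucc - X (Fin.last N)) G (Fin.snoc (α := fun _ => ℤ) γ (C + 1 - ∑ j, γ j))
      = G (Fin.snoc (α := fun _ => ℤ) (γ - Pi.single i 1)
          (C - ∑ j, (γ - Pi.single i 1 : Fin N → ℤ) j))
        - G (Fin.snoc (α := fun _ => ℤ) γ (C - ∑ j, γ j)) := by
  rw [act_X_sub_X]
  congr 2
  · funext j
    refine Fin.lastCases ?_ (fun j => ?_) j
    · simp [Finset.sum_sub_distrib, (Fin.castSucc_lt_last _).ne']
      ring
    · simp [Pi.single_apply]
  · funext j
    refine Fin.lastCases ?_ (fun j => ?_) j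
    · simp
      ring
    · simp [(Fin.castSucc_lt_last _).ne]

theorem sum_Ico_sub_pred (f : ℤ → ℚ) {a T : ℤ} (h : a ≤ T) :
    ∑ t ∈ Finset.Ico (a + 1) (T + 1), (f (t - 1) - f t) = f a - f T := by
  induction T, h using Int.leInduction with
  | base => simp
  | succ T h ih =>
    have : Finset.Ico (a + 1) (T + 1 + 1) = insert (T + 1) (Finset.Ico (a + 1) (T + 1)) := by
      ext x; simp; omega
    rw [this, Finset.sum_insert (by simp), ih]
    simp

theorem inversion {N : ℕ} (T : ℤ) (s : Finset (Fin N)) :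
    ∀ (G : (Fin (N + 1) → ℤ) → ℚ) (C : ℤ) (B : Fin N → ℤ),
      (∀ β, (∃ i ∈ s, T ≤ β i.castSucc) → G β = 0) → (∀ i ∈ s, B i ≤ T) →
      G (Fin.snoc (α := fun _ => ℤ) B (C - ∑ j, B j))
        = ∑ γ ∈ Fintype.piFinset
            (fun i => if i ∈ s then Finset.Ico (B i + 1) (T + 1) else {B i}),
            act _ (∏ i ∈ s, (X i.castSucc - X (Fin.last N))) G
              (Fin.snoc (α := fun _ => ℤ) γ (C + s.card - ∑ j, γ j)) := by
  induction s using Finset.induction_on with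
  | empty =>
    intro G C B _ _
    simp
  | insert i s his ih =>
    intro G C B hG hB
    set G' := act _ (X i.castSucc - X (Fin.last N)) G with hG'
    have hG'0 : ∀ β, (∃ j ∈ s, T ≤ β j.castSucc) → G' β = 0 := by
      rintro β ⟨j, hj, hjT⟩
      have hji : j ≠ i := fun h => his (h ▸ hj)
      rw [hG', act_X_sub_X, hG, hG, sub_zero]
      · exact ⟨j, by simp [hj], by simp [hjT, (Fin.castSucc_lt_last _).ne]⟩
      · exact ⟨j, by simp [hj], by simp [hjT, hji]⟩
    have step : G (Fin.snoc (α := fun _ => ℤ) B (C - ∑ j, B j))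
        = ∑ t ∈ Finset.Ico (B i + 1) (T + 1), G' (Fin.snoc (α := fun _ => ℤ)
            (Function.update B i t) (C + 1 - ∑ j, Function.update B i t j)) := by
      set f : ℤ → ℚ := fun t => G (Fin.snoc (α := fun _ => ℤ)
            (Function.update B i t) (C - ∑ j, Function.update B i t j)) with hf
      have h1 := sum_Ico_sub_pred f (hB i (by simp))
      have h2 : f T = 0 := hG _ ⟨i, by simp, by simp⟩
      have h3 : f (B i) = G (Fin.snoc (α := fun _ => ℤ) B (C - ∑ j, B j)) := by
        show G (Fin.snoc (α := fun _ => ℤ) (Function.update B i (B i))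
          (C - ∑ j, Function.update B i (B i) j)) = _
        rw [Function.update_eq_self]
      rw [h2, h3, sub_zero] at h1
      rw [← h1]
      refine Finset.sum_congr rfl fun t _ => ?_
      rw [hG', act_snoc]
      have h4 : Function.update B i t - Pi.single i 1 = Function.update B i (t - 1) := by
        funext j
        by_cases hj : j = i
        · subst hj; simp
        · simp [hj]
      rw [h4]
    rw [step, ← Finset.sum_fiberwise_of_maps_to (g := fun γ : Fin N → ℤ => γ i)
      (t := Finset.Ico (B i + 1) (T + 1))]
    · refine Finset.sum_congr rfl fun t ht => ?_
      rw [ih G' (C + 1) (Function.update B i t) hG'0]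
      · refine Finset.sum_congr ?_ fun γ _ => ?_
        · ext γ
          simp only [Fintype.mem_piFinset, Finset.mem_filter]
          constructor
          · intro h
            refine ⟨fun j => ?_, ?_⟩
            · by_cases hj : j = i
              · subst hj
                have := h j
                simp [his] at this
                simpa [this] using ht
              · simpa [hj] using h j
            · simpa [his] using h i
          · rintro ⟨h, hi⟩ j
            by_cases hj : j = i
            · subst hj
              simp [his, hi]
            · simpa [hj] using h j
        · rw [Finset.prod_insert his, mul_comm, map_mul, Module.End.mul_apply,
            Finset.card_insert_of_notMem his]
          rw [show C + 1 + (s.card : ℤ) = C + ((s.card + 1 : ℕ) : ℤ) by push_cast; ring]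
      · intro j hj
        have hji : j ≠ i := fun h => his (h ▸ hj)
        simpa [hji] using hB j (by simp [hj])
    · intro γ hγ
      simpa using Fintype.mem_piFinset.1 hγ i

theorem sum_eq_sum_interlacing {N : ℕ} {A : (Fin (N + 1) → ℤ) → ℚ}
    (hA : ∀ i j, i ≠ j → ∀ β, A (β ∘ Equiv.swap i j) = - A β) (C T : ℤ) (lo : Fin N → ℤ)
    (hlo : Antitone lo) (S : Finset (Fin (N + 1) → ℤ))
    (hS : ∀ β, β ∈ S ↔ (∀ i, 0 ≤ β i ∧ β i < T) ∧ ∑ i, β i = C ∧ ∀ i, lo i ≤ β i.castSucc) :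
    ∑ β ∈ S, A β = ∑ β ∈ S with (∀ i : Fin N, β i.succ < lo i), A β := by
  have main : ∀ k ≤ N, ∑ β ∈ S, A β
      = ∑ β ∈ S with (∀ i : Fin N, N - k ≤ (i : ℕ) → β i.succ < lo i), A β := by
    intro k
    induction k with
    | zero =>
      intro _
      rw [Finset.filter_true_of_mem]
      intro β _ i hi
      omega
    | succ k ih =>
      intro hk
      rw [ih (by omega)]
      obtain ⟨m, hm⟩ : ∃ m : Fin N, (m : ℕ) = N - (k + 1) := ⟨⟨N - (k + 1), by omega⟩, rfl⟩
      rw [← Finset.sum_filter_add_sum_filter_not _ (fun β => β m.succ < lo m),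
        Finset.filter_filter, Finset.filter_filter]
      have hz : ∑ β ∈ S with ((∀ i : Fin N, N - k ≤ (i : ℕ) → β i.succ < lo i)
          ∧ ¬ β m.succ < lo m), A β = 0 := by
        have hne : m.castSucc ≠ m.succ := Fin.castSucc_lt_succ.ne
        refine Finset.sum_involution (fun β _ => β ∘ Equiv.swap m.castSucc m.succ) ?_ ?_ ?_ ?_
        · intro β _
          rw [hA _ _ hne]; ring
        · intro β _ h0 h
          have := hA _ _ hne β
          rw [h] at this
          exact h0 (by linarith)
        · intro β hβ
          simp only [Finset.mem_filter, hS] at hβ ⊢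
          obtain ⟨⟨h1, h2, h3⟩, h4, h5⟩ := hβ
          refine ⟨⟨fun i => h1 _, ?_, fun i => ?_⟩, fun i hi => ?_, ?_⟩
          · rw [← h2]; exact Equiv.sum_comp _ β
          · rcases lt_trichotomy (i : ℕ) m with h | h | h
            · rw [Function.comp_apply, Equiv.swap_apply_of_ne_of_ne]
              · exact h3 i
              · intro h'; rw [Fin.ext_iff] at h'; simp at h'; omega
              · intro h'; rw [Fin.ext_iff] at h'; simp at h'; omega
            · have : i = m := Fin.ext h
              subst this
              simpa using h5
            · by_cases h' : i.castSucc = m.succ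
              · rw [h', Function.comp_apply, Equiv.swap_apply_right]
                exact (hlo (by rw [Fin.le_def]; omega)).trans (h3 m)
              · rw [Function.comp_apply, Equiv.swap_apply_of_ne_of_ne _ h']
                · exact h3 i
                · intro h'; rw [Fin.ext_iff] at h'; simp at h'; omega
          · rw [Function.comp_apply, Equiv.swap_apply_of_ne_of_ne]
            · exact h4 i hi
            · intro h'; rw [Fin.ext_iff] at h'; simp at h'; omega
            · intro h'; rw [Fin.ext_iff] at h'; simp at h'; omega
          · simpa using h3 m
        · intro β _
          funext i
          simp
      rw [hz, add_zero]
      refine Finset.sum_congr (Finset.filter_congr fun β _ => ?_) fun _ _ => rfl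
      constructor
      · rintro ⟨h1, h2⟩ i hi
        by_cases h : i = m
        · subst h; exact h2
        · exact h1 i (by have := fun h' => h (Fin.ext h'); omega)
      · intro h
        exact ⟨fun i hi => h i (by omega), h m (by omega)⟩
  rw [main N le_rfl]
  simp

theorem act_prod_eq_alt {N : ℕ} (F : (Fin (N + 1) → ℤ) → ℚ) :
    act _ (∏ i : Fin N, (X i.castSucc - X (Fin.last N)))
      (act _ (∏ i : Fin N, ∏ j ∈ Finset.Ioi i, (X i.castSucc - X j.castSucc)) F)
      = alt (N + 1) F := by
  rw [← act_vandermonde_eq_alt, prod_Ioi_castSucc, mul_comm, map_mul, Module.End.mul_apply]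

theorem sum_delta_succ (N : ℕ) : ∑ i, delta (N + 1) i = ∑ i, delta N i + N := by
  rw [Fin.sum_univ_castSucc]
  have : ∀ i : Fin N, delta (N + 1) i.castSucc = delta N i + 1 := fun i => by
    simp [delta]; ring
  simp only [this, Finset.sum_add_distrib]
  simp [delta]

/-- Integer vectors `a` interlacing `b`, with sum `d`. -/
def IsInterlacing {N : ℕ} (a : Fin (N + 1) → ℤ) (b : Fin N → ℤ) : Prop :=
  ∀ i : Fin N, b i ≤ a i.castSucc ∧ a i.succ ≤ b i

theorem alt_branching {N : ℕ} {F : (Fin (N + 1) → ℤ) → ℚ} (hsym : IsSym F) {d : ℤ}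
    (hF : IsHomog F d) {b : Fin N → ℤ} (hb : Antitone b) (hb0 : ∀ i, 0 ≤ b i)
    (hbd : ∀ i, b i ≤ d) :
    alt N (fun c => F (Fin.snoc (α := fun _ => ℤ) c (d - ∑ i, b i))) (b + delta N)
      = ∑ a ∈ Fintype.piFinset (fun _ => Finset.Icc 0 d) with
          (∑ i, a i = d ∧ IsInterlacing a b), alt (N + 1) F (a + delta (N + 1)) := by
  set T : ℤ := d + N + 1 with hT
  set G := act _ (∏ i : Fin N, ∏ j ∈ Finset.Ioi i, (X i.castSucc - X j.castSucc)) F with hG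
  have hGv : ∀ β, (∃ i ∈ (Finset.univ : Finset (Fin N)), T ≤ β i.castSucc) → G β = 0 := by
    rintro β ⟨i, -, hi⟩
    rw [← Fin.snoc_init_self (α := fun _ => ℤ) β, hG, act_vandermonde_castSucc]
    by_contra h
    obtain ⟨σ, hσ⟩ := exists_of_alt_ne_zero h
    obtain ⟨h0, h1⟩ := hF _ hσ
    have h2 := Finset.single_le_sum (fun j _ => h0 j) (Finset.mem_univ i.castSucc)
    rw [h1] at h2
    have h3 := delta_lt (σ i)
    simp [Fin.init] at h2
    omega
  have h1 := inversion T Finset.univ G (d + ∑ i, delta N i) (b + delta N) hGv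
    (fun i _ => by
      have := hbd i
      have := delta_lt i
      simp only [Pi.add_apply]
      omega)
  rw [hG, act_prod_eq_alt, act_vandermonde_castSucc] at h1
  have h2 : d + ∑ i, delta N i - ∑ j, (b + delta N) j = d - ∑ i, b i := by
    simp only [Pi.add_apply, Finset.sum_add_distrib]; ring
  rw [h2] at h1
  rw [h1]
  set lo : Fin N → ℤ := fun i => b i + delta N i + 1 with hlo
  set C : ℤ := d + ∑ i, delta (N + 1) i with hC
  set S : Finset (Fin (N + 1) → ℤ) := (Fintype.piFinset (fun _ => Finset.Ico 0 (T + 1))).filter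
    (fun β => ∑ i, β i = C ∧ ∀ i, lo i ≤ β i.castSucc) with hS
  have hSm : ∀ β, β ∈ S ↔
      (∀ i, 0 ≤ β i ∧ β i < T + 1) ∧ ∑ i, β i = C ∧ ∀ i, lo i ≤ β i.castSucc := by
    intro β
    simp [hS]
  have hloanti : Antitone lo := by
    intro i j hij
    have := hb hij
    rw [Fin.le_def] at hij
    simp only [hlo, delta]
    omega
  have h3 : ∑ β ∈ S, alt (N + 1) F β
      = ∑ γ ∈ Fintype.piFinset (fun i => if i ∈ (Finset.univ : Finset (Fin N)) then
          Finset.Ico ((b + delta N) i + 1) (T + 1) else {(b + delta N) i}),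
            alt (N + 1) F (Fin.snoc (α := fun _ => ℤ) γ
              (d + ∑ i, delta N i + (Finset.univ : Finset (Fin N)).card - ∑ j, γ j)) := by
    have hsn : ∀ β : Fin (N + 1) → ℤ, ∑ i, β i = C → Fin.snoc (α := fun _ => ℤ) (Fin.init β)
        (d + ∑ i, delta N i + (Finset.univ : Finset (Fin N)).card
          - ∑ j, (Fin.init β : Fin N → ℤ) j) = β := by
      intro β hβ
      conv_rhs => rw [← Fin.snoc_init_self (α := fun _ => ℤ) β]
      congr 1
      rw [Fin.sum_univ_castSucc, hC, sum_delta_succ] at hβ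
      simp only [Finset.card_univ, Fintype.card_fin, Fin.init]
      omega
    refine Finset.sum_of_injOn (fun β => Fin.init β) ?_ ?_ ?_ ?_
    · intro β hβ β' hβ' h
      simp only [Finset.mem_coe, hSm] at hβ hβ'
      have h : (Fin.init β : Fin N → ℤ) = Fin.init β' := h
      rw [← hsn β hβ.2.1, ← hsn β' hβ'.2.1, h]
    · intro β hβ
      simp only [Finset.mem_coe, hSm] at hβ
      simp only [Finset.mem_coe, Fintype.mem_piFinset, Finset.mem_univ, if_true, Finset.mem_Ico]
      intro i
      exact ⟨hβ.2.2 i, (hβ.1 _).2⟩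
    · intro γ hγ hγ'
      by_contra hne
      obtain ⟨g1, g2, g3⟩ := alt_support hF hne
      refine hγ' ⟨Fin.snoc (α := fun _ => ℤ) γ (d + ∑ i, delta N i +
        (Finset.univ : Finset (Fin N)).card - ∑ j, γ j), ?_, Fin.init_snoc (α := fun _ => ℤ) _ _⟩
      simp only [Finset.mem_coe, hSm]
      refine ⟨fun i => ⟨g1 i, ?_⟩, g3, fun i => ?_⟩
      · have := g2 i
        push_cast at this
        omega
      · simp only [Fintype.mem_piFinset, Finset.mem_univ, if_true, Finset.mem_Ico] at hγ
        simpa [hlo] using (hγ i).1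
    · intro β hβ
      rw [hSm] at hβ
      rw [hsn β hβ.2.1]
  rw [← h3, sum_eq_sum_interlacing (fun i j hij β => alt_swap hsym hij β) C (T + 1) lo hloanti S
    hSm]
  have hd1 : ∀ i : Fin N, delta (N + 1) i.castSucc = delta N i + 1 := fun i => by
    simp [delta]; ring
  have hd2 : ∀ i : Fin N, delta (N + 1) i.succ = delta N i := fun i => by
    simp [delta]; ring
  symm
  refine Finset.sum_of_injOn (fun a => a + delta (N + 1)) ?_ ?_ ?_ ?_
  · intro a _ a' _ h
    exact add_right_cancel h
  · intro a ha
    simp only [Finset.coe_filter, Fintype.mem_piFinset, Finset.mem_Icc, Set.mem_ofPred_eq] at ha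
    obtain ⟨ha0, has, hai⟩ := ha
    simp only [Finset.coe_filter, Set.mem_ofPred_eq, hSm]
    refine ⟨⟨fun i => ?_, ?_, fun i => ?_⟩, fun i => ?_⟩
    · have := ha0 i
      have := delta_nonneg i
      have := delta_lt i
      simp only [Pi.add_apply]
      push_cast at this
      omega
    · simp only [Pi.add_apply, Finset.sum_add_distrib]; omega
    · have := (hai i).1
      simp only [Pi.add_apply, hd1, hlo]; omega
    · have := (hai i).2
      simp only [Pi.add_apply, hd2, hlo]; omega
  · intro β hβ hβ'
    by_contra hne
    simp only [Finset.mem_filter, hSm] at hβ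
    obtain ⟨⟨g1, g2, g3⟩, g4⟩ := hβ
    refine hβ' ⟨β - delta (N + 1), ?_, sub_add_cancel _ _⟩
    have hint0 : IsInterlacing (β - delta (N + 1)) b := by
      intro i
      have k1 := g3 i
      have k2 := g4 i
      simp only [Pi.sub_apply, hd1, hd2, hlo] at k1 k2 ⊢
      omega
    have hsum : ∑ i, (β - delta (N + 1)) i = d := by
      simp only [Pi.sub_apply, Finset.sum_sub_distrib]; omega
    have hnn : ∀ i, 0 ≤ (β - delta (N + 1)) i := by
      intro i
      refine Fin.lastCases ?_ (fun i => ?_) i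
      · have := (g1 (Fin.last N)).1
        simpa [delta] using this
      · exact (hb0 i).trans (hint0 i).1
    simp only [Finset.coe_filter, Fintype.mem_piFinset, Finset.mem_Icc, Set.mem_ofPred_eq]
    refine ⟨fun i => ⟨hnn i, ?_⟩, hsum, hint0⟩
    rw [← hsum]
    exact Finset.single_le_sum (fun j _ => hnn j) (Finset.mem_univ i)
  · intro a _
    rfl

/-! ### The recursion for Kostka numbers -/

/-- The tableaux of shape `a` and content `c`. -/
def Tab (a c : ℕ → ℕ) : Set (ℕ → ℕ → ℕ) :=
  {T | IsSSYT a T ∧ ∀ k, skewContent a (fun _ => 0) T k = c k}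

theorem kostka_eq_ncard (a c : ℕ → ℕ) : kostka a c = (Tab a c).ncard := rfl

/-- The cells of a shape with at most `M` rows. -/
def cells (M : ℕ) (a : ℕ → ℕ) : Finset (ℕ × ℕ) :=
  (Finset.range M).biUnion fun i => (Finset.range (a i)).image (Prod.mk i)

theorem mem_cells {M : ℕ} {a : ℕ → ℕ} (ha : ∀ i, M ≤ i → a i = 0) {x : ℕ × ℕ} :
    x ∈ cells M a ↔ x.2 < a x.1 := by
  obtain ⟨i, j⟩ := x
  simp only [cells, Finset.mem_biUnion, Finset.mem_range, Finset.mem_image, Prod.mk.injEq]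
  constructor
  · rintro ⟨i', _, j', h, rfl, rfl⟩
    exact h
  · intro h
    refine ⟨i, ?_, j, h, rfl, rfl⟩
    by_contra hi
    rw [ha i (by omega)] at h
    exact absurd h (Nat.not_lt_zero _)

theorem card_cells (M : ℕ) (a : ℕ → ℕ) : (cells M a).card = ∑ i ∈ Finset.range M, a i := by
  rw [cells, Finset.card_biUnion]
  · refine Finset.sum_congr rfl fun i _ => ?_
    rw [Finset.card_image_of_injective _ (Prod.mk_right_injective i), Finset.card_range]
  · intro i _ i' _ h
    refine Finset.disjoint_left.2 fun x hx hx' => ?_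
    simp only [Finset.mem_image] at hx hx'
    obtain ⟨_, _, rfl⟩ := hx
    obtain ⟨_, _, h'⟩ := hx'
    exact h (congrArg Prod.fst h').symm

theorem skewContent_eq_card {M : ℕ} {a : ℕ → ℕ} (ha : ∀ i, M ≤ i → a i = 0)
    (T : ℕ → ℕ → ℕ) (k : ℕ) :
    skewContent a (fun _ => 0) T k = ((cells M a).filter fun x => T x.1 x.2 = k).card := by
  refine Nat.subtype_card _ fun x => ?_
  rw [Finset.mem_filter, mem_cells ha]
  simp

theorem sum_skewContent {M L : ℕ} {a : ℕ → ℕ} (ha : ∀ i, M ≤ i → a i = 0) {T : ℕ → ℕ → ℕ}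
    (hT : ∀ i j, j < a i → T i j < L) :
    ∑ k ∈ Finset.range L, skewContent a (fun _ => 0) T k = ∑ i ∈ Finset.range M, a i := by
  rw [← card_cells M a, Finset.card_eq_sum_card_fiberwise (f := fun x => T x.1 x.2)
    (t := Finset.range L)]
  · exact Finset.sum_congr rfl fun k _ => skewContent_eq_card ha T k
  · intro x hx
    exact Finset.mem_coe.2 (Finset.mem_range.2 (hT _ _ ((mem_cells ha).1 hx)))

theorem entry_lt {M L : ℕ} {a c : ℕ → ℕ} (ha : ∀ i, M ≤ i → a i = 0) (hc : ∀ k, L ≤ k → c k = 0)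
    {T : ℕ → ℕ → ℕ} (hT : T ∈ Tab a c) {i j : ℕ} (hj : j < a i) : T i j < L := by
  by_contra h
  have h1 := hT.2 (T i j)
  rw [hc _ (not_lt.1 h), skewContent_eq_card ha, Finset.card_eq_zero,
    Finset.filter_eq_empty_iff] at h1
  exact h1 ((mem_cells ha (x := (i, j))).2 hj) rfl

theorem sum_eq_of_mem_tab {M L : ℕ} {a c : ℕ → ℕ} (ha : ∀ i, M ≤ i → a i = 0)
    (hc : ∀ k, L ≤ k → c k = 0) {T : ℕ → ℕ → ℕ} (hT : T ∈ Tab a c) :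
    ∑ i ∈ Finset.range M, a i = ∑ k ∈ Finset.range L, c k := by
  rw [← sum_skewContent ha fun i j => entry_lt ha hc hT]
  exact Finset.sum_congr rfl fun k _ => hT.2 k

theorem finite_tab {M L : ℕ} {a c : ℕ → ℕ} (ha : ∀ i, M ≤ i → a i = 0)
    (hc : ∀ k, L ≤ k → c k = 0) : (Tab a c).Finite := by
  refine Set.Finite.of_injOn (f := fun T (x : cells M a) => T x.1.1 x.1.2)
    (t := Set.pi Set.univ fun _ => Set.Iio L) ?_ ?_ (Set.Finite.pi fun _ => Set.finite_Iio L)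
  · intro T hT x _
    exact entry_lt ha hc hT ((mem_cells ha).1 x.2)
  · intro T hT T' hT' h
    funext i j
    by_cases hj : j < a i
    · exact congrFun h ⟨(i, j), (mem_cells ha).2 hj⟩
    · rw [hT.1.1 i j (not_lt.1 hj), hT'.1.1 i j (not_lt.1 hj)]

theorem le_entry {a : ℕ → ℕ} (ha : Antitone a) {T : ℕ → ℕ → ℕ} (hT : IsSSYT a T) {i j : ℕ}
    (hj : j < a i) : i ≤ T i j := by
  induction i with
  | zero => exact Nat.zero_le _
  | succ i ih =>
    exact Nat.succ_le_of_lt ((ih (hj.trans_le (ha i.le_succ))).trans_lt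
      (hT.2.2 i (i + 1) j i.lt_succ_self hj))

/-- The number of entries smaller than `N` in each row of `T`. -/
def cut (a : ℕ → ℕ) (N : ℕ) (T : ℕ → ℕ → ℕ) (i : ℕ) : ℕ :=
  ((Finset.range (a i)).filter fun j => T i j < N).card

theorem cut_le (a : ℕ → ℕ) (N : ℕ) (T : ℕ → ℕ → ℕ) (i : ℕ) : cut a N T i ≤ a i :=
  (Finset.card_filter_le _ _).trans_eq (Finset.card_range _)

theorem lt_cut_iff {a : ℕ → ℕ} {N : ℕ} {T : ℕ → ℕ → ℕ} (hT : IsSSYT a T) {i j : ℕ}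
    (hj : j < a i) : j < cut a N T i ↔ T i j < N := by
  constructor
  · intro h
    by_contra hN
    refine absurd h (not_lt.2 ?_)
    rw [← Finset.card_range j]
    refine Finset.card_le_card fun j' hj' => ?_
    rw [Finset.mem_filter, Finset.mem_range] at hj'
    rw [Finset.mem_range]
    by_contra hjj
    exact hN ((hT.2.1 i j j' (not_lt.1 hjj) hj'.1).trans_lt hj'.2)
  · intro h
    rw [← Nat.succ_le_iff, ← Finset.card_range j.succ]
    refine Finset.card_le_card fun j' hj' => ?_
    rw [Finset.mem_range] at hj'
    rw [Finset.mem_filter, Finset.mem_range]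
    exact ⟨by omega, (hT.2.1 i j' j (by omega) hj).trans_lt h⟩

/-- Restriction of a filling to a smaller shape. -/
def restr (b : ℕ → ℕ) (T : ℕ → ℕ → ℕ) (i j : ℕ) : ℕ := if j < b i then T i j else 0

/-- Extension of a filling of `b` to the shape `a` by entries `N`. -/
def fill (a b : ℕ → ℕ) (N : ℕ) (T : ℕ → ℕ → ℕ) (i j : ℕ) : ℕ :=
  if j < b i then T i j else if j < a i then N else 0

section Recursion

variable {a b c : ℕ → ℕ} {N : ℕ}

theorem restr_cut_mem {T : ℕ → ℕ → ℕ} (hT : T ∈ Tab a c) :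
    restr (cut a N T) T ∈ Tab (cut a N T) (fun k => if k < N then c k else 0) := by
  have hle := cut_le a N T
  refine ⟨⟨fun i j h => if_neg (not_lt.2 h), fun i j₁ j₂ h h2 => ?_, fun i₁ i₂ j h h2 => ?_⟩,
    fun k => ?_⟩
  · rw [restr, restr, if_pos h2, if_pos (h.trans_lt h2)]
    exact hT.1.2.1 i j₁ j₂ h (h2.trans_le (hle i))
  · rw [restr, restr, if_pos h2]
    have h3 := hT.1.2.2 i₁ i₂ j h (h2.trans_le (hle i₂))
    split_ifs
    · exact h3
    · exact (Nat.zero_le _).trans_lt h3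
  · have key : ∀ i j, j < cut a N T i → T i j < N := fun i j h =>
      (lt_cut_iff hT.1 (h.trans_le (hle i))).1 h
    change _ = if k < N then c k else 0
    rw [← hT.2 k]
    split_ifs with hk
    · refine Nat.card_congr (Equiv.subtypeEquivRight fun x => ?_)
      constructor
      · rintro ⟨h1, h2, h3⟩
        rw [restr, if_pos h2] at h3
        exact ⟨h1, h2.trans_le (hle _), h3⟩
      · rintro ⟨h1, h2, h3⟩
        have h4 : x.2 < cut a N T x.1 := (lt_cut_iff hT.1 h2).2 (h3 ▸ hk)
        exact ⟨h1, h4, by rw [restr, if_pos h4, h3]⟩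
    · refine @Nat.card_of_isEmpty _ ⟨fun x => ?_⟩
      obtain ⟨x, _, h2, h3⟩ := x
      rw [restr, if_pos h2] at h3
      exact hk (h3 ▸ key _ _ h2)

theorem fill_restr_cut {T : ℕ → ℕ → ℕ} (hT : IsSSYT a T)
    (hN : ∀ i j, j < a i → T i j ≤ N) : fill a (cut a N T) N (restr (cut a N T) T) = T := by
  funext i j
  unfold fill restr
  split_ifs with h1 h2
  · rfl
  · have := (lt_cut_iff (N := N) hT h2).not.1 h1
    have := hN i j h2
    omega
  · exact (hT.1 i j (not_lt.1 h2)).symm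

theorem succ_le_cut (ha : Antitone a) {T : ℕ → ℕ → ℕ} (hT : IsSSYT a T)
    (hN : ∀ i j, j < a i → T i j ≤ N) (i : ℕ) : a (i + 1) ≤ cut a N T i := by
  by_contra! h
  have h1 := hT.2.2 i (i + 1) _ i.lt_succ_self h
  have h2 := (lt_cut_iff (N := N) hT (h.trans_le (ha i.le_succ))).not.1 (lt_irrefl _)
  have h3 := hN _ _ h
  omega

theorem cut_eq_zero (ha : Antitone a) {T : ℕ → ℕ → ℕ} (hT : IsSSYT a T) {i : ℕ} (hi : N ≤ i) :
    cut a N T i = 0 := by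
  rw [cut, Finset.card_eq_zero, Finset.filter_eq_empty_iff]
  intro j hj
  have := le_entry ha hT (Finset.mem_range.1 hj)
  omega

theorem fill_mem (ha : ∀ i, N < i → a i = 0) (hc : ∀ k, N < k → c k = 0)
    (hac : ∑ i ∈ Finset.range (N + 1), a i = ∑ i ∈ Finset.range (N + 1), c i)
    (hb : ∀ i, b i ≤ a i) (hb' : ∀ i, a (i + 1) ≤ b i) {T : ℕ → ℕ → ℕ}
    (hT : T ∈ Tab b (fun k => if k < N then c k else 0)) : fill a b N T ∈ Tab a c := by
  have hlt : ∀ i j, j < b i → T i j < N := fun i j hj =>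
    entry_lt (M := N + 1) (fun i hi => Nat.eq_zero_of_le_zero ((hb i).trans_eq (ha i hi)))
      (fun k hk => if_neg (not_lt.2 hk)) hT hj
  have hanti : ∀ i₁ i₂, i₁ < i₂ → a i₂ ≤ b i₁ := by
    intro i₁ i₂ h
    induction i₂, h using Nat.le_induction with
    | base => exact hb' i₁
    | succ k hk ih => exact ((hb' k).trans (hb k)).trans ih
  have hle : ∀ i j, j < a i → fill a b N T i j < N + 1 := by
    intro i j hj
    unfold fill
    rw [if_pos hj]
    split_ifs with h
    · exact (hlt i j h).trans N.lt_succ_self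
    · exact N.lt_succ_self
  have hcont : ∀ k, k < N → skewContent a (fun _ => 0) (fill a b N T) k = c k := by
    intro k hk
    have h := hT.2 k
    simp only [if_pos hk] at h
    rw [← h]
    refine Nat.card_congr (Equiv.subtypeEquivRight fun x => ?_)
    constructor
    · rintro ⟨h1, h2, h3⟩
      unfold fill at h3
      rw [if_pos h2] at h3
      split_ifs at h3 with h4
      · exact ⟨h1, h4, h3⟩
      · omega
    · rintro ⟨h1, h2, h3⟩
      exact ⟨h1, h2.trans_le (hb _), by rw [fill, if_pos h2, h3]⟩
  refine ⟨⟨fun i j h => ?_, fun i j₁ j₂ h h2 => ?_, fun i₁ i₂ j h h2 => ?_⟩, fun k => ?_⟩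
  · have := hb i
    rw [fill, if_neg (by omega), if_neg (by omega)]
  · by_cases h3 : j₂ < b i
    · rw [fill, fill, if_pos h3, if_pos (h.trans_lt h3)]
      exact hT.1.2.1 i j₁ j₂ h h3
    · have h4 := hle i j₁ (h.trans_lt h2)
      conv_rhs => rw [fill, if_neg h3, if_pos h2]
      omega
  · have h1 : j < b i₁ := h2.trans_le (hanti _ _ h)
    conv_lhs => rw [fill, if_pos h1]
    unfold fill
    rw [if_pos h2]
    split_ifs with h3
    · exact hT.1.2.2 _ _ _ h h3
    · exact hlt _ _ h1
  · rcases lt_trichotomy k N with hk | rfl | hk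
    · exact hcont k hk
    · have h := sum_skewContent (M := k + 1) (fun i hi => ha i hi) hle
      rw [hac, Finset.sum_range_succ, Finset.sum_range_succ, Finset.sum_congr rfl fun i hi =>
        hcont i (Finset.mem_range.1 hi)] at h
      exact Nat.add_left_cancel h
    · rw [hc k hk, skewContent_eq_card (M := N + 1) fun i hi => ha i hi, Finset.card_eq_zero,
        Finset.filter_eq_empty_iff]
      intro x hx
      have := hle _ _ ((mem_cells (M := N + 1) fun i hi => ha i hi).1 hx)
      omega

theorem cut_fill (hb : ∀ i, b i ≤ a i) {T : ℕ → ℕ → ℕ}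
    (hT : ∀ i j, j < b i → T i j < N) : cut a N (fill a b N T) = b := by
  funext i
  rw [cut, ← Finset.card_range (b i)]
  congr 1
  ext j
  have := hb i
  rw [Finset.mem_filter, Finset.mem_range, Finset.mem_range]
  constructor
  · rintro ⟨h1, h2⟩
    by_contra h
    rw [fill, if_neg h, if_pos h1] at h2
    omega
  · intro h
    refine ⟨by omega, ?_⟩
    rw [fill, if_pos h]
    exact hT i j h

theorem restr_fill {T : ℕ → ℕ → ℕ} (hT : IsSSYT b T) : restr b (fill a b N T) = T := by
  funext i j
  unfold restr fill
  split_ifs with h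
  · rfl
  · exact (hT.1 i j (not_lt.1 h)).symm

/-- Removing the entries `N` from a tableau of shape `a` with cut `b`. -/
theorem ncard_cut_eq (ha0 : ∀ i, N < i → a i = 0) (hc : ∀ k, N < k → c k = 0)
    (hac : ∑ i ∈ Finset.range (N + 1), a i = ∑ i ∈ Finset.range (N + 1), c i)
    (hb : ∀ i, b i ≤ a i) (hb' : ∀ i, a (i + 1) ≤ b i) :
    {T ∈ Tab a c | cut a N T = b}.ncard = kostka b (fun k => if k < N then c k else 0) := by
  rw [kostka_eq_ncard]
  refine Set.ncard_congr (fun T _ => restr b T) ?_ ?_ ?_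
  · rintro T ⟨hT, rfl⟩
    exact restr_cut_mem hT
  · rintro T T' ⟨hT, rfl⟩ ⟨hT', h'⟩ h
    have e : ∀ {T}, T ∈ Tab a c → ∀ i j, j < a i → T i j ≤ N := fun hT i j hj =>
      Nat.lt_succ_iff.1 (entry_lt (M := N + 1) (fun i hi => ha0 i hi) (fun k hk => hc k hk) hT hj)
    rw [← fill_restr_cut hT.1 (e hT), ← fill_restr_cut hT'.1 (e hT'), h']
    exact congrArg _ h
  · intro T hT
    refine ⟨fill a b N T, ⟨fill_mem ha0 hc hac hb hb' hT, cut_fill hb fun i j hj => ?_⟩,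
      restr_fill hT.1⟩
    exact entry_lt (M := N + 1) (fun i hi => Nat.eq_zero_of_le_zero ((hb i).trans_eq (ha0 i hi)))
      (fun k hk => if_neg (not_lt.2 hk)) hT hj

end Recursion

/-! ### Young's rule -/

theorem extc_coe {N : ℕ} (c : Fin N → ℕ) (i : Fin N) : extc c i = c i := by
  simp [extc]

theorem extc_of_le {N : ℕ} (c : Fin N → ℕ) {i : ℕ} (h : N ≤ i) : extc c i = 0 :=
  dif_neg (not_lt.2 h)

theorem sum_range_extc {N : ℕ} (c : Fin N → ℕ) : ∑ i ∈ Finset.range N, extc c i = ∑ i, c i := by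
  rw [Finset.sum_range]
  exact Finset.sum_congr rfl fun i _ => extc_coe c i

theorem antitone_extc {N : ℕ} {c : Fin N → ℕ} (hc : Antitone c) : Antitone (extc c) := by
  intro i j hij
  by_cases hj : j < N
  · have hi : i < N := hij.trans_lt hj
    simp only [extc, dif_pos hj, dif_pos hi]
    exact hc hij
  · rw [extc_of_le c (not_lt.1 hj)]
    exact Nat.zero_le _

theorem extc_init {N : ℕ} (c : Fin (N + 1) → ℕ) :
    extc (Fin.init c : Fin N → ℕ) = fun k => if k < N then extc c k else 0 := by
  funext k
  split_ifs with h
  · have h' : k < N + 1 := h.trans N.lt_succ_self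
    simp only [extc, dif_pos h, dif_pos h']
    rfl
  · exact extc_of_le _ (not_lt.1 h)

/-- Kostka numbers for integer vectors. -/
noncomputable def kz {N : ℕ} (a : Fin N → ℤ) (c : Fin N → ℕ) : ℕ :=
  kostka (extc fun i => (a i).toNat) (extc c)

theorem kz_succ {N : ℕ} {a : Fin (N + 1) → ℤ} (ha : Antitone a) (ha0 : ∀ i, 0 ≤ a i)
    (c : Fin (N + 1) → ℕ) (hd : ∑ i, a i = ∑ i, (c i : ℤ)) :
    kz a c = ∑ b ∈ Fintype.piFinset (fun _ => Finset.Icc 0 (∑ i : Fin N, (c i.castSucc : ℤ))) with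
      (Antitone b ∧ ∑ i, b i = ∑ i : Fin N, (c i.castSucc : ℤ)) ∧ IsInterlacing a b,
        kz b (Fin.init c : Fin N → ℕ) := by
  set A : ℕ → ℕ := extc fun i => (a i).toNat with hA
  set e : ℤ := ∑ i : Fin N, (c i.castSucc : ℤ) with he
  have hAa : Antitone A := antitone_extc fun i j h => Int.toNat_le_toNat (ha h)
  have hA0 : ∀ i, N + 1 ≤ i → A i = 0 := fun i hi => extc_of_le _ hi
  have hC0 : ∀ i, N + 1 ≤ i → extc c i = 0 := fun i hi => extc_of_le _ hi
  have hAc : ∀ i : Fin (N + 1), (A i : ℤ) = a i := fun i => by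
    rw [hA, extc_coe, Int.toNat_of_nonneg (ha0 i)]
  have hAC : ∑ i ∈ Finset.range (N + 1), A i = ∑ i ∈ Finset.range (N + 1), extc c i := by
    rw [hA, sum_range_extc, sum_range_extc]
    zify
    rw [← hd]
    exact Finset.sum_congr rfl fun i _ => Int.toNat_of_nonneg (ha0 i)
  have hfin := finite_tab hA0 hC0
  have hbd : ∀ T ∈ Tab A (extc c), ∀ i j, j < A i → T i j ≤ N := fun T hT i j hj =>
    Nat.lt_succ_iff.1 (entry_lt hA0 hC0 hT hj)
  have hcut0 : ∀ T ∈ Tab A (extc c), ∀ i, N ≤ i → cut A N T i = 0 := fun T hT i hi =>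
    cut_eq_zero hAa hT.1 hi
  rw [kz, kostka_eq_ncard, Set.ncard_eq_toFinset_card _ hfin,
    Finset.card_eq_sum_card_fiberwise (f := fun T (i : Fin N) => (cut A N T i : ℤ))]
  · refine Finset.sum_congr rfl fun b hb => ?_
    simp only [Finset.mem_filter, Fintype.mem_piFinset, Finset.mem_Icc] at hb
    obtain ⟨hb0, ⟨hba, hbs⟩, hbi⟩ := hb
    set B : ℕ → ℕ := extc fun i => (b i).toNat with hB
    have hBc : ∀ i : Fin N, (B i : ℤ) = b i := fun i => by
      rw [hB, extc_coe, Int.toNat_of_nonneg (hb0 i).1]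
    have hB0 : ∀ i, N ≤ i → B i = 0 := fun i hi => extc_of_le _ hi
    rw [kz, extc_init, ← ncard_cut_eq hA0 hC0 hAC (b := B), ← Set.ncard_coe_finset]
    · congr 1
      ext T
      simp only [Finset.coe_filter, Set.Finite.mem_toFinset, Set.mem_ofPred_eq]
      refine and_congr_right fun hT => ?_
      constructor
      · intro h
        funext i
        by_cases hi : i < N
        · have h1 := congrFun h ⟨i, hi⟩
          have h2 := hBc ⟨i, hi⟩
          simp only at h1 h2
          omega
        · rw [hcut0 T hT i (not_lt.1 hi), hB0 i (not_lt.1 hi)]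
      · intro h
        funext i
        rw [h, hBc]
    · intro i
      by_cases hi : i < N
      · have h1 := hBc ⟨i, hi⟩
        have h2 := hAc (Fin.castSucc ⟨i, hi⟩)
        have h3 := (hbi ⟨i, hi⟩).1
        simp only [Fin.val_castSucc] at h1 h2
        omega
      · rw [hB0 i (not_lt.1 hi)]
        exact Nat.zero_le _
    · intro i
      by_cases hi : i < N
      · have h1 := hBc ⟨i, hi⟩
        have h2 := hAc (Fin.succ ⟨i, hi⟩)
        have h3 := (hbi ⟨i, hi⟩).2
        simp only [Fin.val_succ] at h1 h2
        omega
      · rw [hA0 (i + 1) (by omega)]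
        exact Nat.zero_le _
  · intro T hT
    rw [Finset.mem_coe, Set.Finite.mem_toFinset] at hT
    have hint0 : ∀ i, A (i + 1) ≤ cut A N T i := succ_le_cut hAa hT.1 (hbd T hT)
    have hsum : ∑ i : Fin N, (cut A N T i : ℤ) = e := by
      have h := sum_eq_of_mem_tab (M := N) (L := N) (hcut0 T hT)
        (fun k hk => if_neg (not_lt.2 hk)) (restr_cut_mem hT)
      rw [Finset.sum_range, Finset.sum_range] at h
      zify at h
      rw [h]
      refine Finset.sum_congr rfl fun i _ => ?_
      rw [if_pos (Int.ofNat_lt.2 i.2)]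
      exact congrArg _ (extc_coe c i.castSucc)
    simp only [Finset.coe_filter, Fintype.mem_piFinset, Finset.mem_Icc, Set.mem_ofPred_eq]
    refine ⟨fun i => ⟨Int.natCast_nonneg _, ?_⟩, ⟨fun i j hij => ?_, hsum⟩, fun i => ⟨?_, ?_⟩⟩
    · rw [← hsum]
      exact Finset.single_le_sum (f := fun i : Fin N => (cut A N T i : ℤ))
        (fun j _ => Int.natCast_nonneg _) (Finset.mem_univ i)
    · rcases hij.eq_or_lt with rfl | hij
      · exact le_rfl
      · exact Int.ofNat_le.2 ((cut_le A N T j).trans ((hAa (Nat.succ_le_of_lt hij)).trans (hint0 i)))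
    · rw [← hAc]
      exact Int.ofNat_le.2 (cut_le A N T i)
    · rw [← hAc]
      exact Int.ofNat_le.2 (hint0 i)

theorem kz_zero (a : Fin 0 → ℤ) (c : Fin 0 → ℕ) : kz a c = 1 := by
  rw [kz, kostka_eq_ncard, Set.ncard_eq_one]
  have h0 : ∀ (f : Fin 0 → ℕ) (i : ℕ), extc f i = 0 := fun f i => extc_of_le f (Nat.zero_le i)
  refine ⟨fun _ _ => 0, Set.eq_singleton_iff_unique_mem.2 ⟨⟨⟨fun _ _ _ => rfl, ?_, ?_⟩, ?_⟩, ?_⟩⟩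
  · exact fun _ _ _ _ _ => le_rfl
  · intro _ _ _ _ h
    rw [h0] at h
    exact absurd h (Nat.not_lt_zero _)
  · intro k
    rw [h0, skewContent_eq_card (M := 0) (fun i _ => h0 _ i)]
    rfl
  · intro T hT
    funext i j
    exact hT.1.1 i j ((h0 _ i).trans_le (Nat.zero_le _))

/-- The partitions of `d` with at most `N` parts. -/
noncomputable def parts (N : ℕ) (d : ℤ) : Finset (Fin N → ℤ) :=
  (Fintype.piFinset fun _ => Finset.Icc 0 d).filter fun a => Antitone a ∧ ∑ i, a i = d

theorem mem_parts {N : ℕ} {d : ℤ} {a : Fin N → ℤ} :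
    a ∈ parts N d ↔ (∀ i, 0 ≤ a i) ∧ Antitone a ∧ ∑ i, a i = d := by
  simp only [parts, Finset.mem_filter, Fintype.mem_piFinset, Finset.mem_Icc]
  constructor
  · rintro ⟨h, h'⟩
    exact ⟨fun i => (h i).1, h'⟩
  · rintro ⟨h, h1, h2⟩
    refine ⟨fun i => ⟨h i, ?_⟩, h1, h2⟩
    rw [← h2]
    exact Finset.single_le_sum (fun j _ => h j) (Finset.mem_univ i)

theorem IsInterlacing.antitone {N : ℕ} {a : Fin (N + 1) → ℤ} {b : Fin N → ℤ}
    (h : IsInterlacing a b) : Antitone a :=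
  Fin.antitone_iff_succ_le.2 fun i => (h i).2.trans (h i).1

theorem isSym_snoc {N : ℕ} {F : (Fin (N + 1) → ℤ) → ℚ} (hF : IsSym F) (k : ℤ) :
    IsSym fun c : Fin N → ℤ => F (Fin.snoc (α := fun _ => ℤ) c k) := by
  intro τ c
  set τ' : Perm (Fin (N + 1)) := finSumFinEquiv.permCongr (Perm.sumCongr τ 1) with hτ'
  have h1 : ∀ i : Fin N, τ' i.castSucc = (τ i).castSucc := fun i => by
    rw [hτ', Equiv.permCongr_apply, show i.castSucc = finSumFinEquiv (Sum.inl i) from rfl,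
      Equiv.symm_apply_apply]
    rfl
  have h2 : τ' (Fin.last N) = Fin.last N := by
    rw [hτ', Equiv.permCongr_apply, show Fin.last N = finSumFinEquiv (Sum.inr 0) from rfl,
      Equiv.symm_apply_apply]
    rfl
  refine (congrArg F ?_).trans (hF τ' _)
  funext i
  refine Fin.lastCases ?_ (fun i => ?_) i
  · simp [h2]
  · simp [h1]

theorem isHomog_snoc {N : ℕ} {F : (Fin (N + 1) → ℤ) → ℚ} {d : ℤ} (hF : IsHomog F d) (k : ℤ) :
    IsHomog (fun c : Fin N → ℤ => F (Fin.snoc (α := fun _ => ℤ) c k)) (d - k) := by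
  intro c hc
  obtain ⟨h1, h2⟩ := hF _ hc
  rw [Fin.sum_univ_castSucc] at h2
  simp only [Fin.snoc_castSucc, Fin.snoc_last] at h2
  refine ⟨fun i => ?_, by omega⟩
  simpa using h1 i.castSucc

theorem young_rule {N : ℕ} {F : (Fin N → ℤ) → ℚ} (hsym : IsSym F) {d : ℤ} (hF : IsHomog F d)
    (c : Fin N → ℕ) (hc : ∑ i, (c i : ℤ) = d) :
    F (fun i => c i) = ∑ a ∈ parts N d, (kz a c : ℚ) * alt N F (a + delta N) := by
  induction N generalizing d with
  | zero =>
    have hd : d = 0 := by simpa using hc.symm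
    subst hd
    have : parts 0 0 = {fun i => (c i : ℤ)} := by
      ext a
      rw [mem_parts, Finset.mem_singleton]
      exact ⟨fun _ => Subsingleton.elim _ _, fun _ =>
        ⟨fun i => i.elim0, fun i => i.elim0, by simp⟩⟩
    rw [this, Finset.sum_singleton, kz_zero, Nat.cast_one, one_mul, alt, Fintype.sum_unique]
    simp only [Perm.default_eq, Perm.sign_one, Units.val_one, Int.cast_one, one_mul]
    exact congrArg F (Subsingleton.elim _ _)
  | succ N ih =>
    obtain ⟨k, hk⟩ : ∃ k : ℤ, k = (c (Fin.last N) : ℤ) := ⟨_, rfl⟩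
    have hsum : ∑ i : Fin N, (c i.castSucc : ℤ) = d - k := by
      rw [← hc, Fin.sum_univ_castSucc, hk]
      ring
    have h1 := ih (isSym_snoc hsym k) (isHomog_snoc hF k) (Fin.init c : Fin N → ℕ) hsum
    have h2 : (Fin.snoc (α := fun _ => ℤ) (fun i => ((Fin.init c : Fin N → ℕ) i : ℤ)) k)
        = fun i => (c i : ℤ) := by
      funext i
      refine Fin.lastCases ?_ (fun i => ?_) i
      · simp [hk]
      · simp [Fin.init]
    simp only [h2] at h1
    rw [h1]
    have hk0 : 0 ≤ k := hk ▸ Int.natCast_nonneg _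
    have h3 : ∀ b ∈ parts N (d - k),
        alt N (fun c => F (Fin.snoc (α := fun _ => ℤ) c k)) (b + delta N)
          = ∑ a ∈ parts (N + 1) d with IsInterlacing a b, alt (N + 1) F (a + delta (N + 1)) := by
      intro b hb
      obtain ⟨hb0, hb1, hb2⟩ := mem_parts.1 hb
      have h := alt_branching hsym hF hb1 hb0 fun i => by
        have := Finset.single_le_sum (fun j _ => hb0 j) (Finset.mem_univ i)
        omega
      rw [hb2, sub_sub_cancel] at h
      rw [h]
      refine Finset.sum_congr ?_ fun _ _ => rfl
      ext a
      simp only [parts, Finset.mem_filter]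
      constructor
      · rintro ⟨g1, g2, g3⟩
        exact ⟨⟨g1, g3.antitone, g2⟩, g3⟩
      · rintro ⟨⟨g1, g3, g2⟩, g4⟩
        exact ⟨g1, g2, g4⟩
    rw [Finset.sum_congr rfl fun b hb => by rw [h3 b hb, Finset.mul_sum],
      Finset.sum_comm' (t' := parts (N + 1) d)
        (s' := fun a => (parts N (d - k)).filter fun b => IsInterlacing a b)]
    · refine Finset.sum_congr rfl fun a ha => ?_
      obtain ⟨ha0, ha1, ha2⟩ := mem_parts.1 ha
      rw [← Finset.sum_mul, kz_succ ha1 ha0 c (ha2.trans hc.symm), hsum, parts,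
        Finset.filter_filter, Nat.cast_sum]
    · intro b a
      simp only [Finset.mem_filter]
      tauto

/-! ### Permutation characters as weight counts -/

theorem alt_stable {N : ℕ} {F : (Fin (N + 1) → ℤ) → ℚ} (hsym : IsSym F) {d : ℤ}
    (hF : IsHomog F d) {b : Fin N → ℤ} (hb : b ∈ parts N d) :
    alt (N + 1) F (Fin.snoc (α := fun _ => ℤ) b 0 + delta (N + 1))
      = alt N (fun c => F (Fin.snoc (α := fun _ => ℤ) c 0)) (b + delta N) := by
  obtain ⟨hb0, hb1, hb2⟩ := mem_parts.1 hb
  have hbd : ∀ i, b i ≤ d := fun i => by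
    have := Finset.single_le_sum (fun j _ => hb0 j) (Finset.mem_univ i)
    omega
  have h := alt_branching hsym hF hb1 hb0 hbd
  rw [hb2, sub_self] at h
  rw [h]
  have : (Fintype.piFinset (fun _ : Fin (N + 1) => Finset.Icc 0 d)).filter
      (fun a => ∑ i, a i = d ∧ IsInterlacing a b) = {Fin.snoc (α := fun _ => ℤ) b 0} := by
    ext a
    simp only [Finset.mem_filter, Fintype.mem_piFinset, Finset.mem_Icc, Finset.mem_singleton]
    constructor
    · rintro ⟨h0, hs, hi⟩
      rw [Fin.sum_univ_castSucc] at hs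
      have h1 : ∑ i, b i ≤ ∑ i, a (Fin.castSucc i) := Finset.sum_le_sum fun i _ => (hi i).1
      have h2 := (h0 (Fin.last N)).1
      have h3 : ∑ i, b i = ∑ i, a (Fin.castSucc i) := by omega
      have h4 := (Finset.sum_eq_sum_iff_of_le fun i _ => (hi i).1).1 h3
      funext i
      refine Fin.lastCases ?_ (fun i => ?_) i
      · rw [Fin.snoc_last]
        omega
      · rw [Fin.snoc_castSucc]
        exact (h4 i (Finset.mem_univ i)).symm
    · rintro rfl
      have hd : 0 ≤ d := hb2 ▸ Finset.sum_nonneg fun i _ => hb0 i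
      refine ⟨fun i => ?_, ?_, fun i => ⟨by simp, ?_⟩⟩
      · refine Fin.lastCases ?_ (fun i => ?_) i
        · simpa using hd
        · simpa using ⟨hb0 i, hbd i⟩
      · rw [Fin.sum_univ_castSucc]
        simpa using hb2
      · rcases Fin.eq_castSucc_or_eq_last i.succ with ⟨j, hj⟩ | hj
        · rw [hj, Fin.snoc_castSucc]
          refine hb1 ?_
          have := congrArg Fin.val hj
          simp only [Fin.val_succ, Fin.val_castSucc] at this
          rw [Fin.le_def]
          omega
        · rw [hj, Fin.snoc_last]
          exact hb0 i
  rw [this, Finset.sum_singleton]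

/-- The content of a coloring `h` of points with weights `s`. -/
def cont {O : Type*} [Fintype O] (s : O → ℕ) {N : ℕ} (h : O → Fin N) : Fin N → ℤ :=
  ∑ o, Pi.single (h o) (s o : ℤ)

/-- The number of colorings with content `c` of points with weights `s`. -/
noncomputable def wt {O : Type*} [Fintype O] (s : O → ℕ) (N : ℕ) (c : Fin N → ℤ) : ℚ :=
  ∑ h : O → Fin N, if cont s h = c then 1 else 0

section Weights

variable {O : Type*} [Fintype O] (s : O → ℕ) {N : ℕ}

theorem cont_apply (h : O → Fin N) (i : Fin N) :
    cont s h i = ∑ o, if h o = i then (s o : ℤ) else 0 := by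
  rw [cont, Finset.sum_apply]
  refine Finset.sum_congr rfl fun o _ => ?_
  rw [Pi.single_apply]
  simp only [eq_comm]

theorem cont_nonneg (h : O → Fin N) (i : Fin N) : 0 ≤ cont s h i := by
  rw [cont_apply]
  exact Finset.sum_nonneg fun o _ => by split_ifs <;> simp

theorem sum_cont (h : O → Fin N) : ∑ i, cont s h i = ∑ o, (s o : ℤ) := by
  simp only [cont_apply]
  rw [Finset.sum_comm]
  simp

theorem wt_eq_card (c : Fin N → ℤ) : wt s N c = Nat.card {h : O → Fin N // cont s h = c} := by
  rw [wt, Finset.sum_boole, Nat.subtype_card]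
  simp

theorem isHomog_wt : IsHomog (wt s N) (∑ o, (s o : ℤ)) := by
  intro c hc
  obtain ⟨h, _, hh⟩ := Finset.exists_ne_zero_of_sum_ne_zero hc
  have hcc : cont s h = c := by
    by_contra h'
    exact hh (if_neg h')
  exact ⟨fun i => hcc ▸ cont_nonneg s h i, hcc ▸ sum_cont s h⟩

theorem isSym_wt : IsSym (wt s N) := by
  intro τ c
  rw [wt, wt]
  conv_rhs => rw [← Equiv.sum_comp (Equiv.arrowCongr (Equiv.refl O) τ)]
  refine Finset.sum_congr rfl fun h _ => ?_
  congr 1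
  rw [eq_iff_iff]
  have : ∀ i, cont s (Equiv.arrowCongr (Equiv.refl O) τ h) (τ i) = cont s h i := fun i => by
    simp [cont_apply]
  constructor
  · intro hh
    funext i
    obtain ⟨i, rfl⟩ := τ.surjective i
    rw [this, hh, Function.comp_apply]
  · intro hh
    funext i
    rw [← this, hh, Function.comp_apply]

theorem wt_equiv {O' : Type*} [Fintype O'] (e : O' ≃ O) : wt (s ∘ e) N = wt s N := by
  funext c
  rw [wt, wt, ← Equiv.sum_comp (Equiv.arrowCongr e (Equiv.refl (Fin N)))]
  refine Finset.sum_congr rfl fun h _ => ?_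
  have : cont (s ∘ e) h = cont s (Equiv.arrowCongr e (Equiv.refl (Fin N)) h) := by
    rw [cont, cont, ← Equiv.sum_comp e]
    simp
  rw [this]

end Weights

theorem wt_succ {k N : ℕ} (s : Fin (k + 1) → ℕ) (c : Fin N → ℤ) :
    wt s N c = ∑ i, wt (fun j => s (Fin.succ j)) N (c - Pi.single i (s 0 : ℤ)) := by
  simp only [wt]
  refine Eq.trans (Finset.sum_equiv (t := Finset.univ) (Fin.consEquiv fun _ => Fin N).symm
    (g := fun x => if cont s (Fin.cons (α := fun _ => Fin N) x.1 x.2) = c then 1 else 0)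
    (by simp) fun h _ => ?_) ?_
  · simp [Fin.consEquiv]
  rw [Fintype.sum_prod_type]
  refine Finset.sum_congr rfl fun i _ =>
    Finset.sum_congr (Finset.ext fun _ => by simp) fun h _ => ?_
  congr 1
  rw [cont, Fin.sum_univ_succ, eq_iff_iff, eq_sub_iff_add_eq']
  rfl

theorem alt_wt_succ {k N : ℕ} (s : Fin (k + 1) → ℕ) (β : Fin N → ℤ) :
    alt N (wt s N) β
      = ∑ i, alt N (wt (fun j => s (Fin.succ j)) N) (β - Pi.single i (s 0 : ℤ)) := by
  simp only [alt, wt_succ s, Finset.mul_sum]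
  rw [Finset.sum_comm]
  refine Finset.sum_congr rfl fun i _ => Finset.sum_congr rfl fun σ _ => ?_
  congr 2
  funext j
  simp only [Pi.sub_apply]
  ring

/-- The orbits of a permutation. -/
abbrev Orb {n : ℕ} (g : Perm (Fin n)) : Type := Quotient (Perm.SameCycle.setoid g)

/-- The sizes of the orbits of a permutation. -/
noncomputable def osize {n : ℕ} (g : Perm (Fin n)) (o : Orb g) : ℕ :=
  (Finset.univ.filter fun x : Fin n => (Quotient.mk _ x : Orb g) = o).card

theorem sum_osize {n : ℕ} (g : Perm (Fin n)) : ∑ o, (osize g o : ℤ) = n := by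
  have := Finset.card_eq_sum_card_fiberwise (f := fun x : Fin n => (Quotient.mk _ x : Orb g))
    (s := Finset.univ) (t := Finset.univ) fun _ _ => Finset.mem_coe.2 (Finset.mem_univ _)
  rw [Finset.card_univ, Fintype.card_fin] at this
  rw [← Nat.cast_sum]
  exact congrArg _ this.symm

theorem osize_pos {n : ℕ} (g : Perm (Fin n)) (o : Orb g) : 0 < osize g o := by
  obtain ⟨x, rfl⟩ := Quotient.exists_rep o
  exact Finset.card_pos.2 ⟨x, Finset.mem_filter.2 ⟨Finset.mem_univ _, rfl⟩⟩

theorem eq_of_sameCycle {n : ℕ} {g : Perm (Fin n)} {α : Type*} {f : Fin n → α}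
    (hf : ∀ x, f (g x) = f x) {x y : Fin n} (h : g.SameCycle x y) : f x = f y := by
  obtain ⟨i, rfl⟩ := h
  have h1 : ∀ (m : ℕ) x, f ((g ^ m) x) = f x := by
    intro m
    induction m with
    | zero => exact fun _ => rfl
    | succ m ih =>
      intro x
      rw [pow_succ', Perm.mul_apply, hf, ih]
  have h2 := isOfFinOrder_of_finite g
  obtain ⟨m, hm⟩ := (h2.mem_powers_iff_mem_zpowers (y := g ^ i)).2 ⟨i, rfl⟩
  have hm : g ^ m = g ^ i := hm
  rw [← hm, h1]

/-- Extension of an integer vector by zeros. -/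
def extz {N : ℕ} (c : Fin N → ℤ) (i : ℕ) : ℤ := if h : i < N then c ⟨i, h⟩ else 0

theorem extz_coe {N : ℕ} (c : Fin N → ℤ) (i : Fin N) : extz c i = c i := by
  simp [extz]

theorem cont_osize {n N : ℕ} (g : Perm (Fin n)) (h : Orb g → Fin N) (i : Fin N) :
    cont (osize g) h i = Nat.card {x : Fin n // h (Quotient.mk _ x) = i} := by
  rw [Nat.subtype_card (Finset.univ.filter fun x : Fin n => h (Quotient.mk _ x) = i) (by simp),
    Finset.card_eq_sum_card_fiberwise (f := fun x : Fin n => (Quotient.mk _ x : Orb g))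
      (t := Finset.univ) fun _ _ => Finset.mem_coe.2 (Finset.mem_univ _), cont_apply, Nat.cast_sum]
  refine Finset.sum_congr rfl fun o _ => ?_
  rw [Finset.filter_filter]
  split_ifs with ho
  · refine congrArg _ (congrArg _ (Finset.filter_congr fun x _ => ?_))
    exact ⟨fun hx => ⟨hx ▸ ho, hx⟩, fun hx => hx.2⟩
  · rw [eq_comm, Nat.cast_eq_zero, Finset.card_eq_zero, Finset.filter_eq_empty_iff]
    rintro x _ ⟨h1, rfl⟩
    exact ho h1

theorem permCharZ_extz {n N : ℕ} (c : Fin N → ℤ) (g : Perm (Fin n)) :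
    permCharZ n (extz c) g = wt (osize g) N c := by
  unfold permCharZ
  split_ifs with h0
  · have hc0 : ∀ i, 0 ≤ c i := fun i => by simpa [extz] using h0 i
    rw [wt_eq_card, permChar]
    have hcount : ∀ h : {h : Orb g → Fin N // cont (osize g) h = c}, ∀ k,
        Nat.card {x : Fin n // (h.1 (Quotient.mk _ x) : ℕ) = k} = (extz c k).toNat := by
      intro h k
      by_cases hk : k < N
      · have h1 := cont_osize g h.1 ⟨k, hk⟩
        rw [h.2] at h1
        rw [extz, dif_pos hk, h1, Int.toNat_natCast]
        exact Nat.card_congr (Equiv.subtypeEquivRight fun x =>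
          (Fin.ext_iff (a := h.1 (Quotient.mk _ x)) (b := ⟨k, hk⟩)).symm)
      · rw [extz, dif_neg hk]
        refine @Nat.card_of_isEmpty _ ⟨fun x => hk ?_⟩
        rw [← x.2]
        exact Fin.is_lt _
    have hinv : ∀ h : {h : Orb g → Fin N // cont (osize g) h = c}, ∀ x,
        (h.1 (Quotient.mk _ (g x)) : ℕ) = h.1 (Quotient.mk _ x) := by
      intro h x
      have h1 : (Quotient.mk _ (g x) : Orb g) = Quotient.mk _ x :=
        Quotient.sound' (Perm.sameCycle_apply_left.2 (Perm.SameCycle.refl g x))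
      rw [h1]
    refine congrArg _ (Nat.card_eq_of_bijective (fun h => ⟨fun x => (h.1 (Quotient.mk _ x) : ℕ),
      hcount h, hinv h⟩) ⟨?_, ?_⟩).symm
    · intro h h' hh
      refine Subtype.ext (funext fun o => ?_)
      obtain ⟨x, rfl⟩ := Quotient.exists_rep o
      exact Fin.ext (congrFun (congrArg Subtype.val hh) x)
    · rintro ⟨f, hf, hfg⟩
      have hlt : ∀ x, f x < N := fun x => by
        by_contra hx
        have h1 := hf (f x)
        rw [extz, dif_neg hx, Int.toNat_zero, Nat.card_eq_zero] at h1
        rcases h1 with h1 | h1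
        · exact h1.false ⟨x, rfl⟩
        · exact h1.not_finite inferInstance
      refine ⟨⟨Quotient.lift (fun x => (⟨f x, hlt x⟩ : Fin N)) fun x y hxy =>
        Fin.ext (eq_of_sameCycle hfg hxy), funext fun i => ?_⟩, rfl⟩
      rw [cont_osize]
      have h1 := hf i
      rw [extz_coe] at h1
      rw [← Int.toNat_of_nonneg (hc0 i), ← h1]
      exact congrArg _ (Nat.card_congr (Equiv.subtypeEquivRight fun x => Fin.ext_iff))
  · by_contra hne
    have h1 := (isHomog_wt (osize g) c (Ne.symm hne)).1
    refine h0 fun k => ?_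
    unfold extz
    split_ifs
    · exact h1 _
    · exact le_rfl

theorem irrChar_eq_alt {n : ℕ} (a : ℕ → ℕ) (g : Perm (Fin n)) :
    irrChar n a g = alt n (wt (osize g) n) (fun i => a i + delta n i) := by
  unfold irrChar alt
  refine Finset.sum_congr rfl fun σ _ => ?_
  rw [← permCharZ_extz]
  congr 2
  funext i
  unfold extz
  split_ifs with h
  · simp only [delta]
    ring
  · rfl

theorem permChar_extc {n p : ℕ} (l : Fin p → ℕ) (g : Perm (Fin n)) :
    permChar n (extc l) g = wt (osize g) p (fun i => l i) := by
  rw [← permCharZ_extz, permCharZ, if_pos]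
  · congr 1
    funext k
    unfold extc extz
    split_ifs <;> simp
  · intro k
    unfold extz
    split_ifs <;> simp

theorem wt_snoc_zero {n N : ℕ} (g : Perm (Fin n)) (c : Fin N → ℤ) :
    wt (osize g) (N + 1) (Fin.snoc (α := fun _ => ℤ) c 0) = wt (osize g) N c := by
  rw [← permCharZ_extz, ← permCharZ_extz]
  congr 1
  funext i
  unfold extz
  split_ifs with h1 h2 h2
  · exact Fin.snoc_castSucc (α := fun _ => ℤ) 0 c ⟨i, h2⟩
  · obtain rfl : i = N := by omega
    exact Fin.snoc_last (α := fun _ => ℤ) 0 c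
  · omega
  · rfl

/-! ### Partitions as decreasing vectors -/

/-- The decreasing list of parts of a partition. -/
noncomputable def partList {n : ℕ} (P : n.Partition) : List ℕ := (P.parts.sort (· ≤ ·)).reverse

section PartList

variable {n : ℕ} (P : n.Partition)

theorem coe_partList : (partList P : Multiset ℕ) = P.parts := by
  rw [partList, Multiset.coe_reverse, Multiset.sort_eq]

theorem pairwise_partList : (partList P).Pairwise (· ≥ ·) := by
  rw [partList, List.pairwise_reverse]
  exact Multiset.pairwise_sort P.parts (· ≤ ·)

theorem pos_of_mem_partList {i : ℕ} (hi : i ∈ partList P) : 0 < i := by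
  refine P.parts_pos ?_
  rw [← coe_partList]
  exact Multiset.mem_coe.2 hi

theorem sum_partList : (partList P).sum = n := by
  rw [← Multiset.sum_coe, coe_partList, P.parts_sum]

theorem length_partList_le : (partList P).length ≤ n := by
  have := List.card_nsmul_le_sum (partList P) 1 fun x hx => pos_of_mem_partList P hx
  simpa [sum_partList] using this

theorem pf_eq_getD (i : ℕ) : pf P i = (partList P).getD i 0 := rfl

theorem pf_antitone : Antitone (pf P) := by
  intro i j hij
  rw [pf_eq_getD, pf_eq_getD]
  by_cases hj : j < (partList P).length
  · rw [List.getD_eq_getElem _ _ hj, List.getD_eq_getElem _ _ (hij.trans_lt hj)]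
    rcases hij.eq_or_lt with rfl | h
    · exact le_rfl
    · exact List.pairwise_iff_getElem.1 (pairwise_partList P) i j _ _ h
  · rw [List.getD_eq_default _ _ (not_lt.1 hj)]
    exact Nat.zero_le _

theorem pf_of_le {i : ℕ} (hi : n ≤ i) : pf P i = 0 :=
  List.getD_eq_default _ _ ((length_partList_le P).trans hi)

theorem sum_getD (L : List ℕ) {M : ℕ} (h : L.length ≤ M) :
    ∑ i ∈ Finset.range M, L.getD i 0 = L.sum := by
  induction L generalizing M with
  | nil => simp
  | cons x L ih =>
    obtain ⟨M, rfl⟩ : ∃ M', M = M' + 1 := ⟨M - 1, by simp at h; omega⟩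
    rw [Finset.sum_range_succ', List.sum_cons, ← ih (M := M) (by simpa using h)]
    simp [add_comm]

theorem sum_pf {M : ℕ} (h : n ≤ M) : ∑ i ∈ Finset.range M, pf P i = n := by
  exact (sum_getD _ ((length_partList_le P).trans h)).trans (sum_partList P)

theorem pf_ne_zero_iff {i : ℕ} : pf P i ≠ 0 ↔ i < (partList P).length := by
  rw [pf_eq_getD]
  constructor
  · intro h
    by_contra h'
    exact h (List.getD_eq_default _ _ (not_lt.1 h'))
  · intro h
    rw [List.getD_eq_getElem _ _ h]
    exact (pos_of_mem_partList P (List.getElem_mem h)).ne'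

end PartList

theorem pf_injective {n : ℕ} : Function.Injective (pf : n.Partition → ℕ → ℕ) := by
  intro P Q h
  have hlen : (partList P).length = (partList Q).length :=
    eq_of_forall_lt_iff fun i => by rw [← pf_ne_zero_iff, ← pf_ne_zero_iff, h]
  refine Nat.Partition.ext ?_
  rw [← coe_partList, ← coe_partList]
  congr 1
  refine List.ext_getElem hlen fun i h1 h2 => ?_
  have := congrFun h i
  rwa [pf_eq_getD, pf_eq_getD, List.getD_eq_getElem _ _ h1, List.getD_eq_getElem _ _ h2] at this

theorem exists_pf_eq {n M : ℕ} {a : ℕ → ℕ} (ha : Antitone a) (h0 : ∀ i, M ≤ i → a i = 0)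
    (hs : ∑ i ∈ Finset.range M, a i = n) : ∃ P : n.Partition, pf P = a := by
  have hex : ∃ k, a k = 0 := ⟨M, h0 M le_rfl⟩
  set k := Nat.find hex with hk
  have hk0 : ∀ i, k ≤ i → a i = 0 := fun i hi =>
    Nat.eq_zero_of_le_zero ((ha hi).trans_eq (Nat.find_spec hex))
  have hkM : k ≤ M := Nat.find_min' hex (h0 M le_rfl)
  set L := List.ofFn fun i : Fin k => a i with hL
  have hpair : L.Pairwise (· ≥ ·) := by
    rw [List.pairwise_ofFn]
    exact fun i j hij => ha hij.le
  refine ⟨⟨(L : Multiset ℕ), ?_, ?_⟩, ?_⟩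
  · intro i hi
    rw [Multiset.mem_coe, hL, List.mem_ofFn] at hi
    obtain ⟨j, rfl⟩ := hi
    exact Nat.pos_of_ne_zero (Nat.find_min hex j.2)
  · rw [Multiset.sum_coe, hL, List.sum_ofFn, ← hs, Fin.sum_univ_eq_sum_range a k]
    refine Finset.sum_subset (Finset.range_mono hkM) fun i _ hi => hk0 i ?_
    simpa using hi
  · funext i
    rw [pf]
    have : ((L : Multiset ℕ).sort (· ≤ ·)).reverse = L := by
      refine List.Perm.eq_of_pairwise (le := (· ≥ ·))
        (fun a b _ _ h1 h2 => le_antisymm h2 h1) ?_ hpair ?_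
      · rw [List.pairwise_reverse]
        exact Multiset.pairwise_sort _ (· ≤ ·)
      · rw [← Multiset.coe_eq_coe, Multiset.coe_reverse, Multiset.sort_eq]
    simp only [this]
    by_cases hi : i < k
    · rw [List.getD_eq_getElem _ _ (by simpa [hL] using hi)]
      simp [hL]
    · rw [List.getD_eq_default _ _ (by simpa [hL] using hi), hk0 i (not_lt.1 hi)]

theorem pf_mem_parts {n N : ℕ} (h : n ≤ N) (P : n.Partition) :
    (fun i : Fin N => (pf P i : ℤ)) ∈ parts N n := by
  refine mem_parts.2 ⟨fun i => Int.natCast_nonneg _, fun i j hij => ?_, ?_⟩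
  · exact Int.ofNat_le.2 (pf_antitone P hij)
  · rw [← Nat.cast_sum, ← Finset.sum_range (fun i => pf P i), sum_pf P h]

theorem sum_parts {n N : ℕ} (h : n ≤ N) (f : (Fin N → ℤ) → ℚ) :
    ∑ a ∈ parts N n, f a = ∑ P : n.Partition, f (fun i => pf P i) := by
  symm
  refine Finset.sum_bij (fun P _ i => (pf P i : ℤ)) (fun P _ => pf_mem_parts h P) ?_ ?_
    fun _ _ => rfl
  · intro P _ Q _ hPQ
    refine pf_injective (funext fun i => ?_)
    by_cases hi : i < N
    · exact_mod_cast congrFun hPQ ⟨i, hi⟩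
    · rw [pf_of_le P (by omega), pf_of_le Q (by omega)]
  · intro a ha
    obtain ⟨h0, h1, h2⟩ := mem_parts.1 ha
    obtain ⟨P, hP⟩ := exists_pf_eq (n := n) (M := N) (a := extc fun i => (a i).toNat)
      (antitone_extc fun i j hij => Int.toNat_le_toNat (h1 hij)) (fun i hi => extc_of_le _ hi) (by
        rw [sum_range_extc]
        zify
        rw [← h2]
        exact Finset.sum_congr rfl fun i _ => Int.toNat_of_nonneg (h0 i))
    refine ⟨P, Finset.mem_univ _, funext fun i => ?_⟩
    rw [hP, extc_coe, Int.toNat_of_nonneg (h0 i)]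

theorem alt_pf_stable {n : ℕ} (P : n.Partition) (g : Perm (Fin n)) (p : ℕ) :
    alt (n + p) (wt (osize g) (n + p)) ((fun i : Fin (n + p) => (pf P i : ℤ)) + delta (n + p))
      = irrChar n (pf P) g := by
  induction p with
  | zero =>
    rw [irrChar_eq_alt]
    rfl
  | succ p ih =>
    have hF := isHomog_wt (N := n + p + 1) (osize g)
    rw [sum_osize] at hF
    have h := alt_stable (isSym_wt (osize g)) hF (pf_mem_parts (Nat.le_add_right n p) P)
    simp only [wt_snoc_zero] at h
    have e : (fun i : Fin (n + p + 1) => (pf P i : ℤ))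
        = Fin.snoc (α := fun _ => ℤ) (fun i : Fin (n + p) => (pf P i : ℤ)) 0 := by
      funext i
      refine Fin.lastCases ?_ (fun i => ?_) i
      · rw [Fin.snoc_last, Fin.val_last, pf_of_le P (Nat.le_add_right n p)]
        rfl
      · rw [Fin.snoc_castSucc]
        rfl
    rw [← ih, ← h, ← e]
    rfl

theorem permChar_eq_sum {n p : ℕ} (l : Fin p → ℕ) (hl : ∑ i, l i = n) (g : Perm (Fin n)) :
    permChar n (extc l) g
      = ∑ P : n.Partition, (kostka (pf P) (extc l) : ℚ) * irrChar n (pf P) g := by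
  have hext : extc (fun i : Fin (n + p) => extc l i) = extc l := by
    funext i
    by_cases hi : i < n + p
    · exact extc_coe (fun i : Fin (n + p) => extc l i) ⟨i, hi⟩
    · rw [extc_of_le _ (not_lt.1 hi), extc_of_le _ (by omega)]
  have hF := isHomog_wt (N := n + p) (osize g)
  rw [sum_osize] at hF
  have hsum : ∑ i : Fin (n + p), (extc l i : ℤ) = n := by
    have h1 : ∑ i ∈ Finset.range p, extc l i = ∑ i ∈ Finset.range (n + p), extc l i :=
      Finset.sum_subset (Finset.range_mono (Nat.le_add_left p n)) fun i _ hi =>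
        extc_of_le _ (by simpa using hi)
    rw [← Nat.cast_sum, ← Finset.sum_range (fun i => extc l i), ← h1, sum_range_extc, hl]
  have h := young_rule (isSym_wt (osize g)) hF (fun i => extc l i) hsum
  rw [← hext, permChar_extc, h, sum_parts (Nat.le_add_right n p)]
  refine Finset.sum_congr rfl fun P _ => ?_
  rw [alt_pf_stable, kz, hext]
  congr 3
  funext i
  by_cases hi : i < n + p
  · exact (extc_coe (fun i : Fin (n + p) => (pf P i : ℤ).toNat) ⟨i, hi⟩).trans
      (Int.toNat_natCast _)
  · rw [extc_of_le _ (not_lt.1 hi), pf_of_le P (by omega)]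

/-! ### Conjugation of partitions -/

/-- The values of `β` and the reflected values of `γ` partition `{0, …, 2 n - 1}`. -/
structure Complementary {n : ℕ} (β γ : Fin n → ℤ) : Prop where
  left_nonneg : ∀ i, 0 ≤ β i
  left_lt : ∀ i, β i < 2 * n
  right_nonneg : ∀ i, 0 ≤ γ i
  right_lt : ∀ i, γ i < 2 * n
  left_injective : Function.Injective β
  right_injective : Function.Injective γ
  add_ne : ∀ i j, β i + γ j ≠ 2 * n - 1

/-- The sign of the arrangement formed by `β` and the reflection of `γ`. -/
def arrSign {n : ℕ} (β γ : Fin n → ℤ) : ℤ :=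
  Int.sign (Matrix.vandermonde (Fin.append β fun j => 2 * n - 1 - γ j)).det

namespace Complementary

variable {n : ℕ} {β γ : Fin n → ℤ}

theorem symm (h : Complementary β γ) : Complementary γ β :=
  ⟨h.right_nonneg, h.right_lt, h.left_nonneg, h.left_lt, h.right_injective, h.left_injective,
    fun i j => by rw [add_comm]; exact h.add_ne j i⟩

theorem exists_of_lt (h : Complementary β γ) {v : ℤ} (h0 : 0 ≤ v) (hv : v < 2 * n) :
    (∃ i, β i = v) ∨ ∃ j, γ j = 2 * n - 1 - v := by
  let f : Fin n ⊕ Fin n → Fin (2 * n) := Sum.elim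
    (fun i => ⟨(β i).toNat, by have := h.left_lt i; have := h.left_nonneg i; omega⟩)
    (fun j => ⟨(2 * n - 1 - γ j).toNat, by
      have := h.right_lt j; have := h.right_nonneg j; omega⟩)
  have hinj : Function.Injective f := by
    rintro (i | i) (j | j) hij
    · have h1 : (β i).toNat = (β j).toNat := congrArg Fin.val hij
      have := h.left_nonneg i
      have := h.left_nonneg j
      rw [h.left_injective (show β i = β j by omega)]
    · have h1 : (β i).toNat = (2 * n - 1 - γ j).toNat := congrArg Fin.val hij
      have := h.left_nonneg i
      have := h.right_lt j
      have := h.add_ne i j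
      omega
    · have h1 : (2 * n - 1 - γ i).toNat = (β j).toNat := congrArg Fin.val hij
      have := h.left_nonneg j
      have := h.right_lt i
      have := h.add_ne j i
      omega
    · have h1 : (2 * n - 1 - γ i).toNat = (2 * n - 1 - γ j).toNat := congrArg Fin.val hij
      have := h.right_lt i
      have := h.right_lt j
      rw [h.right_injective (show γ i = γ j by omega)]
  have hsurj := ((Fintype.bijective_iff_injective_and_card f).2
    ⟨hinj, by simp [two_mul]⟩).2
  obtain ⟨x | x, hx⟩ := hsurj ⟨v.toNat, by omega⟩
  · left
    have h1 : (β x).toNat = v.toNat := congrArg Fin.val hx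
    have := h.left_nonneg x
    exact ⟨x, by omega⟩
  · right
    have h1 : (2 * n - 1 - γ x).toNat = v.toNat := congrArg Fin.val hx
    have := h.right_lt x
    exact ⟨x, by omega⟩

end Complementary

theorem exists_eq_delta_comp {n : ℕ} {β : Fin n → ℤ} (h0 : ∀ i, 0 ≤ β i) (hn : ∀ i, β i < n)
    (hinj : Function.Injective β) : ∃ σ : Perm (Fin n), β = delta n ∘ σ := by
  let f : Fin n → Fin n := fun i => ⟨(n - 1 - β i).toNat, by
    have := h0 i; have := hn i; omega⟩
  have hf : Function.Injective f := by
    intro i j hij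
    have h1 : (n - 1 - β i).toNat = (n - 1 - β j).toNat := congrArg Fin.val hij
    have := hn i
    have := hn j
    exact hinj (by omega)
  refine ⟨Equiv.ofBijective f (Finite.injective_iff_bijective.1 hf), funext fun i => ?_⟩
  have := hn i
  simp only [Function.comp_apply, Equiv.ofBijective_apply, delta, f]
  omega

theorem Complementary.right_lt_of_left_lt {n : ℕ} {β γ : Fin n → ℤ} (h : Complementary β γ)
    (hβ : ∀ i, β i < n) (j : Fin n) : γ j < n := by
  obtain ⟨σ, hσ⟩ := exists_eq_delta_comp h.left_nonneg hβ h.left_injective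
  by_contra hj
  have h1 := h.right_lt j
  have h2 := h.add_ne (σ.symm ⟨(γ j - n).toNat, by omega⟩) j
  rw [hσ, Function.comp_apply, Equiv.apply_symm_apply, delta] at h2
  simp only at h2
  omega

theorem sign_units_mul (u : ℤˣ) (x : ℤ) : Int.sign (u * x) = u * Int.sign x := by
  rcases Int.units_eq_one_or u with rfl | rfl <;> simp

theorem sign_det_comp {N : ℕ} (w : Fin N → ℤ) (ρ : Perm (Fin N)) :
    Int.sign (Matrix.vandermonde (w ∘ ρ)).det
      = Perm.sign ρ * Int.sign (Matrix.vandermonde w).det := by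
  have h : Matrix.vandermonde (w ∘ ρ) = (Matrix.vandermonde w).submatrix ρ id := rfl
  rw [h, Matrix.det_permute, Int.cast_id, sign_units_mul]

theorem arrSign_comp {n : ℕ} (β γ : Fin n → ℤ) (σ τ : Perm (Fin n)) :
    arrSign (β ∘ σ) (γ ∘ τ) = Perm.sign σ * Perm.sign τ * arrSign β γ := by
  have h : (Fin.append (β ∘ σ) fun j => 2 * n - 1 - (γ ∘ τ) j)
      = (Fin.append β fun j => 2 * n - 1 - γ j) ∘ finSumFinEquiv.permCongr (Perm.sumCongr σ τ) := by
    funext x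
    refine Fin.addCases (fun i => ?_) (fun i => ?_) x
    · simp [Equiv.permCongr_apply]
    · rw [Fin.append_right, Function.comp_apply, Function.comp_apply, Equiv.permCongr_apply,
        finSumFinEquiv_symm_apply_natAdd, Perm.sumCongr_apply, Sum.map_inr,
        finSumFinEquiv_apply_right, Fin.append_right]
  rw [arrSign, h, sign_det_comp, Perm.sign_permCongr, Perm.sign_sumCongr, arrSign]
  push_cast
  ring

theorem arrSign_sub_single {n : ℕ} {β γ : Fin n → ℤ} {i j : Fin n} {r : ℤ}
    (h : β i + γ j = 2 * n - 1 + r) :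
    arrSign (β - Pi.single i r) (γ - Pi.single j r) = -arrSign β γ := by
  have hne : Fin.castAdd n i ≠ Fin.natAdd n j := by
    rw [Ne, Fin.ext_iff, Fin.val_castAdd, Fin.val_natAdd]
    omega
  have h1 : (Fin.append (β - Pi.single i r) fun k => 2 * n - 1 - (γ - Pi.single j r : Fin n → ℤ) k)
      = (Fin.append β fun k => 2 * n - 1 - γ k)
        ∘ Equiv.swap (Fin.castAdd n i) (Fin.natAdd n j) := by
    funext x
    refine Fin.addCases (fun k => ?_) (fun k => ?_) x
    · rw [Function.comp_apply, Fin.append_left]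
      by_cases hk : k = i
      · subst hk
        rw [Equiv.swap_apply_left, Fin.append_right]
        simp
        omega
      · rw [Equiv.swap_apply_of_ne_of_ne, Fin.append_left]
        · simp [hk]
        · simpa using hk
        · rw [Ne, Fin.ext_iff, Fin.val_castAdd, Fin.val_natAdd]
          omega
    · rw [Function.comp_apply, Fin.append_right]
      by_cases hk : k = j
      · subst hk
        rw [Equiv.swap_apply_right, Fin.append_left]
        simp
        omega
      · rw [Equiv.swap_apply_of_ne_of_ne, Fin.append_right]
        · simp [hk]
        · rw [Ne, Fin.ext_iff, Fin.val_castAdd, Fin.val_natAdd]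
          omega
        · simpa using hk
  rw [arrSign, h1, sign_det_comp, Perm.sign_swap hne, arrSign]
  simp

theorem alt_eq_zero {N : ℕ} {F : (Fin N → ℤ) → ℚ} (hF : IsSym F) {β : Fin N → ℤ} {i j : Fin N}
    (hij : i ≠ j) (h : β i = β j) : alt N F β = 0 := by
  have h1 := alt_comp hF (Equiv.swap i j) β
  have h2 : β ∘ Equiv.swap i j = β := by
    funext k
    rw [Function.comp_apply, Equiv.swap_apply_def]
    split_ifs with h3 h4
    · rw [h3, h]
    · rw [h4, h]
    · rfl
  rw [h2, Perm.sign_swap hij] at h1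
  simp at h1
  linarith

theorem Complementary.sum_alt {n : ℕ} {β γ : Fin n → ℤ} (h : Complementary β γ)
    {F : (Fin n → ℤ) → ℚ} (hsym : IsSym F) {d : ℤ} (hF : IsHomog F d) {r : ℤ} (hr : 0 < r) :
    ∑ i, alt n F (β - Pi.single i r)
      = ∑ i, ∑ j, if β i + γ j = 2 * n - 1 + r then alt n F (β - Pi.single i r) else 0 := by
  refine Finset.sum_congr rfl fun i _ => ?_
  by_cases hex : ∃ j, β i + γ j = 2 * n - 1 + r
  · obtain ⟨j, hj⟩ := hex
    rw [Finset.sum_eq_single j, if_pos hj]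
    · intro j' _ hj'
      refine if_neg fun h' => hj' (h.right_injective ?_)
      omega
    · exact fun h' => absurd (Finset.mem_univ j) h'
  · rw [Finset.sum_eq_zero fun j _ => if_neg fun h' => hex ⟨j, h'⟩]
    by_contra hne
    have h1 := (alt_support hF hne).1 i
    rw [Pi.sub_apply, Pi.single_eq_same] at h1
    have h2 := h.left_lt i
    rcases h.exists_of_lt h1 (by omega) with ⟨k, hk⟩ | ⟨j, hj⟩
    · have hki : k ≠ i := by
        rintro rfl
        omega
      exact hne (alt_eq_zero hsym hki (by simp [hki, hk]))
    · exact hex ⟨j, by omega⟩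

theorem Complementary.sub_single {n : ℕ} {β γ : Fin n → ℤ} (h : Complementary β γ) {r : ℤ}
    (hr : 0 < r) {i j : Fin n} (hij : β i + γ j = 2 * n - 1 + r) :
    Complementary (β - Pi.single i r) (γ - Pi.single j r) := by
  have key : ∀ {β γ : Fin n → ℤ} {i j : Fin n}, Complementary β γ →
      β i + γ j = 2 * n - 1 + r → (∀ k, 0 ≤ (β - Pi.single i r : Fin n → ℤ) k) ∧
      (∀ k, (β - Pi.single i r : Fin n → ℤ) k < 2 * n) ∧
      Function.Injective (β - Pi.single i r : Fin n → ℤ) := by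
    intro β γ i j h hij
    refine ⟨fun k => ?_, fun k => ?_, fun k k' hk => ?_⟩
    · have := h.left_nonneg k
      have := h.right_lt j
      by_cases hk : k = i
      · subst hk
        simp only [Pi.sub_apply, Pi.single_eq_same]
        omega
      · simpa [hk] using h.left_nonneg k
    · have := h.left_lt k
      by_cases hk : k = i
      · subst hk
        simp only [Pi.sub_apply, Pi.single_eq_same]
        omega
      · simpa [hk] using h.left_lt k
    · by_cases h1 : k = i <;> by_cases h2 : k' = i
      · rw [h1, h2]
      · subst h1
        have := h.add_ne k' j
        simp [h2] at hk
        omega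
      · subst h2
        have := h.add_ne k j
        simp [h1] at hk
        omega
      · simp [h1, h2] at hk
        exact h.left_injective hk
  obtain ⟨a1, a2, a3⟩ := key h hij
  obtain ⟨b1, b2, b3⟩ := key h.symm (by rw [add_comm]; exact hij)
  refine ⟨a1, a2, b1, b2, a3, b3, fun k l hkl => ?_⟩
  have hb := @h.left_injective
  have hc := @h.right_injective
  by_cases h1 : k = i <;> by_cases h2 : l = j
  · subst h1 h2
    simp at hkl
    omega
  · subst h1
    simp [h2] at hkl
    exact h2 (hc (by omega))
  · subst h2
    simp [h1] at hkl
    exact h1 (hb (by omega))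
  · simp [h1, h2] at hkl
    exact h.add_ne k l hkl

theorem Complementary.alt_wt {n k : ℕ} (s : Fin k → ℕ) (hs : ∀ i, 0 < s i) {β γ : Fin n → ℤ}
    (h : Complementary β γ) :
    alt n (wt s n) β * arrSign β γ
      = (-1) ^ k * alt n (wt s n) γ * arrSign (delta n) (delta n) := by
  induction k generalizing β γ with
  | zero =>
    have hsmall : ∀ {β : Fin n → ℤ}, alt n (wt s n) β ≠ 0 → ∀ i, β i < n := by
      intro β hne i
      simpa using (alt_support (isHomog_wt s) hne).2.1 i
    by_cases hβ : ∀ i, β i < n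
    · have hγ := h.right_lt_of_left_lt hβ
      obtain ⟨σ, rfl⟩ := exists_eq_delta_comp h.left_nonneg hβ h.left_injective
      obtain ⟨τ, rfl⟩ := exists_eq_delta_comp h.right_nonneg hγ h.right_injective
      rw [alt_comp (isSym_wt s), alt_comp (isSym_wt s), arrSign_comp]
      have : (((Perm.sign σ : ℤˣ) : ℤ) : ℚ) * ((Perm.sign σ : ℤˣ) : ℤ) = 1 := by
        rw [← Int.cast_mul, ← Units.val_mul, Int.units_mul_self]
        simp
      push_cast
      linear_combination (((Perm.sign τ : ℤˣ) : ℤ) : ℚ) * alt n (wt s n) (delta n)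
        * arrSign (delta n) (delta n) * this
    · have h1 : alt n (wt s n) β = 0 := by
        by_contra h'
        exact hβ (hsmall h')
      have h2 : alt n (wt s n) γ = 0 := by
        by_contra h'
        exact hβ (h.symm.right_lt_of_left_lt (hsmall h'))
      rw [h1, h2]
      ring
  | succ k ih =>
    have hr : (0 : ℤ) < s 0 := Int.natCast_pos.2 (hs 0)
    have hF := isHomog_wt (N := n) fun j => s (Fin.succ j)
    have hsym := isSym_wt (N := n) fun j => s (Fin.succ j)
    rw [alt_wt_succ, alt_wt_succ, h.sum_alt hsym hF hr, h.symm.sum_alt hsym hF hr,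
      Finset.sum_comm (f := fun i j => if γ i + β j = _ then _ else _)]
    simp only [Finset.sum_mul, Finset.mul_sum]
    refine Finset.sum_congr rfl fun i _ => Finset.sum_congr rfl fun j _ => ?_
    rw [add_comm (γ j)]
    split_ifs with hij
    · have h1 := ih (fun j => s (Fin.succ j)) (fun j => hs _) (h.sub_single hr hij)
      rw [arrSign_sub_single hij] at h1
      rw [pow_succ]
      push_cast at h1
      linear_combination -h1
    · ring

theorem mem_iff_lt_card {S : Finset ℕ} (hS : ∀ i j, i ≤ j → j ∈ S → i ∈ S) (i : ℕ) :
    i ∈ S ↔ i < S.card := by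
  constructor
  · intro hi
    have h : Finset.range (i + 1) ⊆ S := fun j hj =>
      hS j i (Nat.lt_succ_iff.1 (Finset.mem_range.1 hj)) hi
    simpa using Finset.card_le_card h
  · intro hi
    by_contra h
    have h1 : S ⊆ Finset.range i := by
      intro j hj
      rw [Finset.mem_range]
      by_contra h2
      exact h (hS i j (not_lt.1 h2) hj)
    have := Finset.card_le_card h1
    rw [Finset.card_range] at this
    omega

theorem lt_conjFun_iff {n : ℕ} {a : ℕ → ℕ} (ha : Antitone a) {i : ℕ} (hi : i < n) (j : ℕ) :
    i < conjFun n a j ↔ j < a i := by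
  rw [conjFun, ← mem_iff_lt_card]
  · simp [hi]
  · intro i k hik hk
    rw [Finset.mem_filter, Finset.mem_range] at hk ⊢
    exact ⟨hik.trans_lt hk.1, hk.2.trans_le (ha hik)⟩

theorem conjFun_le (n : ℕ) (a : ℕ → ℕ) (j : ℕ) : conjFun n a j ≤ n := by
  simpa [conjFun] using Finset.card_filter_le (Finset.range n) fun i => j < a i

theorem conjFun_antitone (n : ℕ) (a : ℕ → ℕ) : Antitone (conjFun n a) := fun _ _ hij =>
  Finset.card_le_card (Finset.monotone_filter_right _ fun _ _ h => hij.trans_lt h)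

/-- The strictly decreasing vector attached to a partition. -/
def shifted (n : ℕ) (a : ℕ → ℕ) (i : Fin n) : ℤ := a i + delta n i

theorem shifted_strictAnti {n : ℕ} {a : ℕ → ℕ} (ha : Antitone a) : StrictAnti (shifted n a) := by
  intro i j hij
  have h1 : a j ≤ a i := ha hij.le
  have h2 : (i : ℕ) < j := hij
  simp only [shifted, delta]
  omega

theorem complementary_conjFun {n : ℕ} {a : ℕ → ℕ} (ha : Antitone a) (hle : ∀ i, a i ≤ n) :
    Complementary (shifted n a) (shifted n (conjFun n a)) where
  left_nonneg i := by
    have := i.2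
    simp only [shifted, delta]
    omega
  left_lt i := by
    have := hle i
    simp only [shifted, delta]
    omega
  right_nonneg i := by
    have := i.2
    simp only [shifted, delta]
    omega
  right_lt i := by
    have := conjFun_le n a i
    simp only [shifted, delta]
    omega
  left_injective := (shifted_strictAnti ha).injective
  right_injective := (shifted_strictAnti (conjFun_antitone n a)).injective
  add_ne i j := by
    have := lt_conjFun_iff ha i.2 j
    simp only [shifted, delta]
    omega

theorem arrSign_delta_ne_zero (n : ℕ) : arrSign (delta n) (delta n) ≠ 0 := by
  rw [arrSign, Ne, Int.sign_eq_zero_iff_zero, ← Ne, Matrix.det_vandermonde_ne_zero_iff]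
  intro x y
  refine Fin.addCases (fun i => ?_) (fun i => ?_) x <;>
    refine Fin.addCases (fun j => ?_) (fun j => ?_) y <;>
    simp only [Fin.append_left, Fin.append_right, delta, Fin.ext_iff, Fin.val_castAdd,
      Fin.val_natAdd] <;> omega

theorem sign_prod {ι : Type*} (S : Finset ι) (f : ι → ℤ) :
    Int.sign (∏ i ∈ S, f i) = ∏ i ∈ S, Int.sign (f i) :=
  map_prod (⟨⟨Int.sign, rfl⟩, Int.sign_mul⟩ : ℤ →* ℤ) f S

theorem prod_ite_lt {n m : ℕ} (h : m ≤ n) :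
    ∏ j : Fin n, (if (j : ℕ) < m then (-1 : ℤ) else 1) = (-1) ^ m := by
  rw [Finset.prod_ite, Finset.prod_const_one, mul_one, Finset.prod_const]
  congr 1
  rw [Fin.card_filter_val_lt, min_eq_right h]

theorem arrSign_conjFun {n : ℕ} {a : ℕ → ℕ} (ha : Antitone a) (hle : ∀ i, a i ≤ n) :
    arrSign (shifted n a) (shifted n (conjFun n a))
      = (-1) ^ (∑ i : Fin n, a i) * arrSign (delta n) (delta n) := by
  let e : Fin (n + n) → Fin (n + n) → ℤ := fun x y =>
    if (x : ℕ) < n ∧ n ≤ (y : ℕ) ∧ (y : ℕ) - n < a x then -1 else 1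
  have he : ∏ x, ∏ y ∈ Finset.Ioi x, e x y = (-1) ^ (∑ i : Fin n, a i) := by
    have h1 : ∀ x, ∏ y ∈ Finset.Ioi x, e x y = ∏ y, e x y := by
      intro x
      refine Finset.prod_subset (Finset.subset_univ _) fun y _ hy => if_neg fun h => hy ?_
      rw [Finset.mem_Ioi, Fin.lt_def]
      omega
    simp only [h1, Fin.prod_univ_add]
    simp only [e, Fin.val_castAdd, Fin.val_natAdd]
    rw [← Finset.prod_pow_eq_pow_sum]
    have h2 : ∀ j : Fin n, ¬n ≤ (j : ℕ) := fun j => by omega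
    simp [prod_ite_lt, hle, h2]
  rw [arrSign, arrSign, Matrix.det_vandermonde, Matrix.det_vandermonde, ← he]
  simp only [sign_prod, ← Finset.prod_mul_distrib]
  refine Finset.prod_congr rfl fun x _ => Finset.prod_congr rfl fun y hy => ?_
  rw [Finset.mem_Ioi] at hy
  revert hy
  have pos : ∀ {u v : ℤ}, 0 < u → 0 < v → Int.sign u = Int.sign v := fun hu hv => by
    rw [Int.sign_eq_one_of_pos hu, Int.sign_eq_one_of_pos hv]
  have neg : ∀ {u v : ℤ}, u < 0 → v < 0 → Int.sign u = Int.sign v := fun hu hv => by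
    rw [Int.sign_eq_neg_one_of_neg hu, Int.sign_eq_neg_one_of_neg hv]
  refine Fin.addCases (fun i => ?_) (fun i => ?_) x <;>
    refine Fin.addCases (fun j => ?_) (fun j => ?_) y <;> intro hy <;>
    simp only [e, Fin.append_left, Fin.append_right, Fin.lt_def, Fin.val_castAdd,
      Fin.val_natAdd] at hy ⊢
  · rw [if_neg (by omega), one_mul]
    have := shifted_strictAnti ha (show i < j from hy)
    refine neg (by omega) ?_
    simp only [delta]
    omega
  · have h1 := lt_conjFun_iff ha i.2 j
    have h2 := i.2
    by_cases hj : (j : ℕ) < a i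
    · rw [if_pos ⟨i.2, by omega, by omega⟩, Int.sign_eq_neg_one_of_neg, Int.sign_eq_one_of_pos]
      · rfl
      · simp only [delta]
        omega
      · simp only [shifted, delta]
        omega
    · rw [if_neg (by omega), one_mul]
      refine pos ?_ ?_
      · simp only [shifted, delta]
        omega
      · simp only [delta]
        omega
  · have := j.2
    omega
  · rw [if_neg (by omega), one_mul]
    have := shifted_strictAnti (conjFun_antitone n a) (show i < j by rw [Fin.lt_def]; omega)
    refine pos (by omega) ?_
    simp only [delta]
    omega

theorem irrChar_conjFun {n : ℕ} {a : ℕ → ℕ} (ha : Antitone a)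
    (hsum : ∑ i ∈ Finset.range n, a i = n) (hz : ∀ i, n ≤ i → a i = 0) (g : Perm (Fin n)) :
    irrChar n (conjFun n a) g = (-1) ^ (n + Fintype.card (Orb g)) * irrChar n a g := by
  have hle : ∀ i, a i ≤ n := by
    intro i
    by_cases hi : i < n
    · exact (Finset.single_le_sum (fun _ _ => Nat.zero_le _) (Finset.mem_range.2 hi)).trans_eq hsum
    · rw [hz i (not_lt.1 hi)]
      exact Nat.zero_le n
  have h := (complementary_conjFun ha hle).alt_wt
    (fun i => osize g ((Fintype.equivFin (Orb g)).symm i)) fun i => osize_pos g _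
  have hw := wt_equiv (N := n) (osize g) (Fintype.equivFin (Orb g)).symm
  rw [show (fun i => osize g ((Fintype.equivFin (Orb g)).symm i))
    = osize g ∘ (Fintype.equivFin (Orb g)).symm from rfl, hw, arrSign_conjFun ha hle,
    Finset.sum_range (fun i => a i) |>.symm.trans hsum] at h
  rw [irrChar_eq_alt, irrChar_eq_alt]
  change alt n _ (shifted n (conjFun n a)) = _ * alt n _ (shifted n a)
  have h0 : (arrSign (delta n) (delta n) : ℚ) ≠ 0 := Int.cast_ne_zero.2 (arrSign_delta_ne_zero n)
  have h1 : ((-1 : ℚ) ^ Fintype.card (Orb g)) * (-1) ^ Fintype.card (Orb g) = 1 := by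
    rw [← mul_pow]
    simp
  refine mul_right_cancel₀ h0 ?_
  push_cast at h
  rw [pow_add]
  linear_combination (-(-1) ^ Fintype.card (Orb g)) * h
    - alt n (wt (osize g) n) (shifted n (conjFun n a)) * arrSign (delta n) (delta n) * h1

/-! ### The sign of a permutation in terms of its orbits -/

theorem card_orb {n : ℕ} (g : Perm (Fin n)) :
    Fintype.card (Orb g) = g.cycleFactorsFinset.card + (n - g.support.card) := by
  let ψ : Orb g → Perm (Fin n) ⊕ Fin n := fun o => Quotient.liftOn o
    (fun x => if g x = x then Sum.inr x else Sum.inl (g.cycleOf x)) (by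
      intro x y (hxy : g.SameCycle x y)
      by_cases hx : g x = x
      · rw [hxy.eq_of_left hx]
      · have hy : g y ≠ y := fun hy => hx (by rw [hxy.eq_of_right hy]; exact hy)
        simp only [if_neg hx, if_neg hy, hxy.cycleOf_eq])
  have hψ : Function.Injective ψ := by
    intro o o'
    induction o using Quotient.inductionOn with | _ x
    induction o' using Quotient.inductionOn with | _ y
    intro h
    change (if g x = x then Sum.inr x else Sum.inl (g.cycleOf x))
      = if g y = y then Sum.inr y else Sum.inl (g.cycleOf y) at h
    split_ifs at h with hx hy hy
    · rw [Sum.inr.inj h]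
    · refine Quotient.sound (?_ : g.SameCycle x y)
      have h1 : y ∈ (g.cycleOf x).support := by
        rw [Sum.inl.inj h, Perm.mem_support_cycleOf_iff]
        exact ⟨Perm.SameCycle.refl _ _, Perm.mem_support.2 hy⟩
      exact (Perm.mem_support_cycleOf_iff.1 h1).1
  have himage : Finset.univ.image ψ = g.cycleFactorsFinset.disjSum g.supportᶜ := by
    ext z
    rw [Finset.mem_image]
    constructor
    · rintro ⟨o, -, rfl⟩
      induction o using Quotient.inductionOn with | _ x
      change (if g x = x then Sum.inr x else Sum.inl (g.cycleOf x)) ∈ _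
      split_ifs with hx
      · simpa using hx
      · rw [Finset.inl_mem_disjSum, Perm.cycleOf_mem_cycleFactorsFinset_iff, Perm.mem_support]
        exact hx
    · rcases z with c | x
      · intro hc
        rw [Finset.inl_mem_disjSum] at hc
        obtain ⟨x, hx⟩ := (Perm.mem_cycleFactorsFinset_iff.1 hc).1.nonempty_support
        refine ⟨Quotient.mk _ x, Finset.mem_univ _, ?_⟩
        change (if g x = x then Sum.inr x else Sum.inl (g.cycleOf x)) = _
        rw [if_neg, (Perm.cycle_is_cycleOf hx hc)]
        exact Perm.mem_support.1 (Perm.mem_cycleFactorsFinset_support_le hc hx)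
      · intro hx
        rw [Finset.inr_mem_disjSum, Finset.mem_compl, Perm.mem_support, not_not] at hx
        exact ⟨Quotient.mk _ x, Finset.mem_univ _, if_pos hx⟩
  rw [← Finset.card_univ, ← Finset.card_image_of_injective _ hψ, himage, Finset.card_disjSum,
    Finset.card_compl, Fintype.card_fin]

theorem sign_eq_neg_one_pow {n : ℕ} (g : Perm (Fin n)) :
    ((Perm.sign g : ℤˣ) : ℤ) = (-1) ^ (n + Fintype.card (Orb g)) := by
  have h1 : g.support.card ≤ n := by simpa using Finset.card_le_univ g.support
  have h2 : g.cycleType.card = g.cycleFactorsFinset.card := by simp [Perm.cycleType_def]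
  rw [Perm.sign_of_cycleType, Perm.sum_cycleType, h2, card_orb]
  push_cast
  obtain ⟨k, hk⟩ := Nat.exists_eq_add_of_le h1
  rw [show n + (g.cycleFactorsFinset.card + (n - g.support.card))
    = (g.support.card + g.cycleFactorsFinset.card) + 2 * k by omega, pow_add _ _ (2 * k), pow_mul]
  simp

theorem irrChar_conjFun_pf {n : ℕ} (P : n.Partition) (g : Perm (Fin n)) :
    irrChar n (conjFun n (pf P)) g = ((Perm.sign g : ℤˣ) : ℤ) * irrChar n (pf P) g := by
  rw [irrChar_conjFun (pf_antitone P) (sum_pf P le_rfl) (fun i => pf_of_le P), sign_eq_neg_one_pow]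
  push_cast
  rfl

/-! ### Binary matrices and colorings -/

/-- The fiber sizes of `f` are given by `l`. -/
def HasFibers {X K : Type*} [Fintype X] [DecidableEq K] (f : X → K) (l : K → ℕ) : Prop :=
  ∀ k, (Finset.univ.filter fun x => f x = k).card = l k

theorem permChar_eq_sum_ite {n p : ℕ} (l : Fin p → ℕ) (g : Perm (Fin n)) :
    permChar n (extc l) g
      = ∑ f : Fin n → Fin p, if HasFibers f l ∧ ∀ x, f (g x) = f x then 1 else 0 := by
  rw [Finset.sum_boole, ← Fintype.card_subtype, ← Nat.card_eq_fintype_card, permChar]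
  congr 1
  symm
  have hfib : ∀ (f : Fin n → Fin p) (k : Fin p), Nat.card {x : Fin n // (f x : ℕ) = k}
      = (Finset.univ.filter fun x => f x = k).card := by
    intro f k
    rw [Nat.subtype_card]
    simp [Fin.ext_iff]
  refine Nat.card_congr (Equiv.ofBijective (fun f => ⟨fun x => (f.1 x : ℕ), ?_, ?_⟩) ⟨?_, ?_⟩)
  · intro k
    by_cases hk : k < p
    · rw [extc, dif_pos hk, ← f.2.1 ⟨k, hk⟩]
      exact hfib f.1 ⟨k, hk⟩
    · rw [extc, dif_neg hk, Nat.card_eq_zero]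
      left
      exact ⟨fun x => hk (x.2 ▸ (f.1 x.1).2)⟩
  · intro x
    exact congrArg Fin.val (f.2.2 x)
  · intro f f' h
    refine Subtype.ext (funext fun x => Fin.ext ?_)
    exact congrFun (congrArg Subtype.val h) x
  · rintro ⟨f, h1, h2⟩
    have hlt : ∀ x, f x < p := by
      intro x
      by_contra hx
      have h3 := h1 (f x)
      rw [extc, dif_neg hx, Finite.card_eq_zero_iff] at h3
      exact h3.false ⟨x, rfl⟩
    refine ⟨⟨fun x => ⟨f x, hlt x⟩, fun k => ?_, fun x => Fin.ext (h2 x)⟩, rfl⟩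
    refine (hfib (fun x => ⟨f x, hlt x⟩) k).symm.trans ?_
    rw [← extc_coe l k, ← h1]

theorem sum_sign_stabilizer {n : ℕ} {X : Type*} [DecidableEq X] (F : Fin n → X) :
    ∑ g : Perm (Fin n), (if ∀ x, F (g x) = F x then (((Perm.sign g : ℤˣ) : ℤ) : ℚ) else 0)
      = if Function.Injective F then 1 else 0 := by
  split_ifs with hF
  · rw [Finset.sum_eq_single 1]
    · simp
    · intro g _ hg
      exact if_neg fun h => hg (Equiv.ext fun x => hF (h x))
    · simp
  · simp only [Function.Injective, not_forall] at hF
    obtain ⟨a, b, hab, hne⟩ := hF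
    have hswap : ∀ y, F (Equiv.swap a b y) = F y := by
      intro y
      rw [Equiv.swap_apply_def]
      split_ifs with h1 h2
      · rw [h1, hab]
      · rw [h2, hab]
      · rfl
    have h := Equiv.sum_comp (Equiv.mulLeft (Equiv.swap a b)) fun g : Perm (Fin n) =>
      if ∀ x, F (g x) = F x then (((Perm.sign g : ℤˣ) : ℤ) : ℚ) else 0
    simp only [Equiv.coe_mulLeft, Perm.mul_apply, hswap, Perm.sign_mul, Perm.sign_swap hne] at h
    rw [← self_eq_neg, ← Finset.sum_neg_distrib]
    refine h.symm.trans (Finset.sum_congr rfl fun g _ => ?_)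
    split_ifs <;> simp

/-- The numbers of points of `S` in the layers of the box are given by `l`, `m` and `ν`. -/
def HasMarginals {p q r : ℕ} (S : Finset (Fin p × Fin q × Fin r))
    (l : Fin p → ℕ) (m : Fin q → ℕ) (ν : Fin r → ℕ) : Prop :=
  (∀ i, (S.filter fun s => s.1 = i).card = l i) ∧ (∀ j, (S.filter fun s => s.2.1 = j).card = m j) ∧
    ∀ k, (S.filter fun s => s.2.2 = k).card = ν k

variable {p q r : ℕ}

theorem HasMarginals.card_eq {S : Finset (Fin p × Fin q × Fin r)} {l : Fin p → ℕ} {m : Fin q → ℕ}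
    {ν : Fin r → ℕ} (h : HasMarginals S l m ν) : S.card = ∑ i, l i := by
  rw [Finset.card_eq_sum_card_fiberwise (f := Prod.fst) (t := Finset.univ) (by simp [Set.MapsTo])]
  exact Finset.sum_congr rfl fun i _ => h.1 i

/-- The indicator matrix of a subset of the box. -/
def indicatorMatrix (S : Finset (Fin p × Fin q × Fin r)) (i : Fin p) (j : Fin q) (k : Fin r) : ℕ :=
  if (i, j, k) ∈ S then 1 else 0

theorem hasMarginals_iff (S : Finset (Fin p × Fin q × Fin r)) (l : Fin p → ℕ) (m : Fin q → ℕ)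
    (ν : Fin r → ℕ) : HasMarginals S l m ν ↔
      (∀ i, ∑ j, ∑ k, indicatorMatrix S i j k = l i) ∧
      (∀ j, ∑ i, ∑ k, indicatorMatrix S i j k = m j) ∧
      ∀ k, ∑ i, ∑ j, indicatorMatrix S i j k = ν k := by
  have h : ∀ (P : Fin p × Fin q × Fin r → Prop) [DecidablePred P], (S.filter P).card
      = ∑ i, ∑ j, ∑ k, if P (i, j, k) then indicatorMatrix S i j k else 0 := by
    intro P _
    rw [show S.filter P = Finset.univ.filter fun s => P s ∧ s ∈ S by ext; simp [and_comm],
      Finset.card_filter]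
    simp only [ite_and, Fintype.sum_prod_type, indicatorMatrix]
  have h1 : ∀ i, (S.filter fun s => s.1 = i).card = ∑ j, ∑ k, indicatorMatrix S i j k := by
    intro i
    rw [h, Finset.sum_eq_single i] <;> simp +contextual
  have h2 : ∀ j, (S.filter fun s => s.2.1 = j).card = ∑ i, ∑ k, indicatorMatrix S i j k := by
    intro j
    rw [h]
    refine Finset.sum_congr rfl fun i _ => ?_
    rw [Finset.sum_eq_single j] <;> simp +contextual
  have h3 : ∀ k, (S.filter fun s => s.2.2 = k).card = ∑ i, ∑ j, indicatorMatrix S i j k := by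
    intro k
    rw [h]
    simp
  simp only [HasMarginals, h1, h2, h3]

theorem card_matrices (l : Fin p → ℕ) (m : Fin q → ℕ) (ν : Fin r → ℕ) :
    Nat.card {A : Fin p → Fin q → Fin r → ℕ // (∀ i j k, A i j k ≤ 1) ∧
        (∀ i, ∑ j, ∑ k, A i j k = l i) ∧ (∀ j, ∑ i, ∑ k, A i j k = m j) ∧
        (∀ k, ∑ i, ∑ j, A i j k = ν k)}
      = (Finset.univ.filter fun S : Finset (Fin p × Fin q × Fin r) =>
          HasMarginals S l m ν).card := by
  rw [← Fintype.card_subtype, ← Nat.card_eq_fintype_card]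
  symm
  refine Nat.card_congr (Equiv.ofBijective (fun S => ⟨indicatorMatrix S.1, fun i j k => ?_,
    (hasMarginals_iff S.1 l m ν).1 S.2⟩) ⟨?_, ?_⟩)
  · rw [indicatorMatrix]
    split_ifs <;> simp
  · intro S S' h
    refine Subtype.ext (Finset.ext fun ⟨i, j, k⟩ => ?_)
    have h1 : indicatorMatrix S.1 i j k = indicatorMatrix S'.1 i j k := by
      rw [Subtype.mk.inj h]
    simp only [indicatorMatrix] at h1
    split_ifs at h1 <;> simp_all
  · rintro ⟨A, hA, hm⟩
    have h1 : indicatorMatrix (Finset.univ.filter fun s => A s.1 s.2.1 s.2.2 = 1) = A := by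
      funext i j k
      have := hA i j k
      simp only [indicatorMatrix, Finset.mem_filter, Finset.mem_univ, true_and]
      split_ifs <;> omega
    refine ⟨⟨Finset.univ.filter fun s => A s.1 s.2.1 s.2.2 = 1, ?_⟩, Subtype.ext h1⟩
    rw [hasMarginals_iff, h1]
    exact hm

theorem card_injective_image_eq {X : Type*} [Fintype X] [DecidableEq X] {n : ℕ} {S : Finset X}
    (hS : S.card = n) :
    (Finset.univ.filter fun F : Fin n → X =>
      Function.Injective F ∧ Finset.univ.image F = S).card = n.factorial := by
  have h : Fintype.card (Fin n ≃ S) = n.factorial := by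
    rw [Fintype.card_equiv (Fintype.equivOfCardEq (by simp [hS])), Fintype.card_fin]
  rw [← h, ← Fintype.card_subtype]
  symm
  refine Fintype.card_congr (Equiv.ofBijective (fun e => ⟨fun x => (e x : X),
    fun x y hxy => e.injective (Subtype.ext hxy), ?_⟩) ⟨?_, ?_⟩)
  · ext s
    rw [Finset.mem_image]
    constructor
    · rintro ⟨x, -, rfl⟩
      exact (e x).2
    · exact fun hs => ⟨e.symm ⟨s, hs⟩, Finset.mem_univ _, by simp⟩
  · intro e e' h
    exact Equiv.ext fun x => Subtype.ext (congrFun (congrArg Subtype.val h) x)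
  · rintro ⟨F, hF, rfl⟩
    refine ⟨Equiv.ofBijective (fun x => ⟨F x, Finset.mem_image_of_mem F (Finset.mem_univ x)⟩)
      ⟨fun x y hxy => hF (congrArg Subtype.val hxy), fun s => ?_⟩, rfl⟩
    obtain ⟨x, -, hx⟩ := Finset.mem_image.1 s.2
    exact ⟨x, Subtype.ext hx⟩

theorem hasMarginals_image {n : ℕ} {F : Fin n → Fin p × Fin q × Fin r} (hF : Function.Injective F)
    (l : Fin p → ℕ) (m : Fin q → ℕ) (ν : Fin r → ℕ) :
    HasMarginals (Finset.univ.image F) l m ν ↔ HasFibers (fun x => (F x).1) l ∧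
      HasFibers (fun x => (F x).2.1) m ∧ HasFibers (fun x => (F x).2.2) ν := by
  simp only [HasMarginals, HasFibers, Finset.filter_image, Finset.card_image_of_injective _ hF]

theorem card_injective_eq {n : ℕ} (l : Fin p → ℕ) (m : Fin q → ℕ) (ν : Fin r → ℕ)
    (hl : ∑ i, l i = n) :
    (Finset.univ.filter fun F : Fin n → Fin p × Fin q × Fin r =>
      Function.Injective F ∧ HasFibers (fun x => (F x).1) l ∧ HasFibers (fun x => (F x).2.1) m ∧
        HasFibers (fun x => (F x).2.2) ν).card
      = (Finset.univ.filter fun S : Finset (Fin p × Fin q × Fin r) =>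
          HasMarginals S l m ν).card * n.factorial := by
  rw [Finset.card_eq_sum_card_fiberwise (f := fun F => Finset.univ.image F)
    (t := Finset.univ.filter fun S => HasMarginals S l m ν), Finset.sum_const_nat]
  · intro S hS
    rw [Finset.mem_filter] at hS
    rw [← card_injective_image_eq (hS.2.card_eq.trans hl), Finset.filter_filter]
    congr 1
    refine Finset.filter_congr fun F _ => ?_
    constructor
    · exact fun h => ⟨h.1.1, h.2⟩
    · exact fun h => ⟨⟨h.1, (hasMarginals_image h.1 l m ν).1 (h.2 ▸ hS.2)⟩, h.2⟩
  · intro F hF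
    have h := (Finset.mem_filter.1 (Finset.mem_coe.1 hF)).2
    exact Finset.mem_coe.2 (Finset.mem_filter.2
      ⟨Finset.mem_univ _, (hasMarginals_image h.1 l m ν).2 h.2⟩)

theorem sum_sign_mul_permChar {n : ℕ} (l : Fin p → ℕ) (m : Fin q → ℕ) (ν : Fin r → ℕ) :
    ∑ g : Perm (Fin n), (((Perm.sign g : ℤˣ) : ℤ) : ℚ) *
        (permChar n (extc l) g * permChar n (extc m) g * permChar n (extc ν) g)
      = (Finset.univ.filter fun F : Fin n → Fin p × Fin q × Fin r =>
      Function.Injective F ∧ HasFibers (fun x => (F x).1) l ∧ HasFibers (fun x => (F x).2.1) m ∧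
        HasFibers (fun x => (F x).2.2) ν).card := by
  let E : (Fin n → Fin p × Fin q × Fin r) ≃
      (Fin n → Fin p) × (Fin n → Fin q) × (Fin n → Fin r) :=
    (Equiv.arrowProdEquivProdArrow _ _ _).trans
      ((Equiv.refl _).prodCongr (Equiv.arrowProdEquivProdArrow _ _ _))
  have h : ∀ g : Perm (Fin n), (((Perm.sign g : ℤˣ) : ℤ) : ℚ) *
        (permChar n (extc l) g * permChar n (extc m) g * permChar n (extc ν) g)
      = ∑ F : Fin n → Fin p × Fin q × Fin r, if HasFibers (fun x => (F x).1) l ∧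
        HasFibers (fun x => (F x).2.1) m ∧ HasFibers (fun x => (F x).2.2) ν then
          (if ∀ x, F (g x) = F x then (((Perm.sign g : ℤˣ) : ℤ) : ℚ) else 0) else 0 := by
    intro g
    let G : (Fin n → Fin p) × (Fin n → Fin q) × (Fin n → Fin r) → ℚ := fun t =>
      if HasFibers t.1 l ∧ HasFibers t.2.1 m ∧ HasFibers t.2.2 ν then
        (if ∀ x, t.1 (g x) = t.1 x ∧ t.2.1 (g x) = t.2.1 x ∧ t.2.2 (g x) = t.2.2 x then
          (((Perm.sign g : ℤˣ) : ℤ) : ℚ) else 0) else 0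
    refine Eq.trans ?_ ((E.sum_comp G).symm.trans (Finset.sum_congr rfl fun F _ => ?_))
    · rw [permChar_eq_sum_ite, permChar_eq_sum_ite, permChar_eq_sum_ite, mul_assoc,
        Finset.sum_mul_sum, Finset.sum_mul_sum]
      simp only [Finset.mul_sum, Fintype.sum_prod_type]
      refine Finset.sum_congr rfl fun f₁ _ => Finset.sum_congr rfl fun f₂ _ =>
        Finset.sum_congr rfl fun f₃ _ => ?_
      simp only [G, forall_and, ite_and, mul_ite, mul_one, mul_zero]
      split_ifs <;> rfl
    · simp only [G, Prod.ext_iff]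
      rfl
  rw [Finset.sum_congr rfl fun g _ => h g, Finset.sum_comm, ← Finset.sum_boole]
  refine Finset.sum_congr rfl fun F _ => ?_
  split_ifs with h1 h2 h2
  · rw [sum_sign_stabilizer, if_pos h2.1]
  · rw [sum_sign_stabilizer, if_neg fun h3 => h2 ⟨h3, h1⟩]
  · exact absurd h2.2 h1
  · simp

theorem sum_partitions_eq {n p q r : ℕ} (l : Fin p → ℕ) (m : Fin q → ℕ) (ν : Fin r → ℕ)
    (hl : ∑ i, l i = n) (hm : ∑ j, m j = n) (hν : ∑ k, ν k = n) :
    ∑ α : n.Partition, ∑ β : n.Partition, ∑ γ : n.Partition,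
        (kostka (pf α) (extc l) : ℚ) * (kostka (pf β) (extc m) : ℚ) *
          (kostka (pf γ) (extc ν) : ℚ) * kron n (pf α) (pf β) (conjFun n (pf γ))
      = (∑ g : Perm (Fin n), (((Perm.sign g : ℤˣ) : ℤ) : ℚ) *
          (permChar n (extc l) g * permChar n (extc m) g * permChar n (extc ν) g))
        / n.factorial := by
  have h : ∀ g : Perm (Fin n), (((Perm.sign g : ℤˣ) : ℤ) : ℚ) *
      (permChar n (extc l) g * permChar n (extc m) g * permChar n (extc ν) g)
      = ∑ α : n.Partition, ∑ β : n.Partition, ∑ γ : n.Partition,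
        (kostka (pf α) (extc l) : ℚ) * kostka (pf β) (extc m) * kostka (pf γ) (extc ν) *
          (irrChar n (pf α) g * irrChar n (pf β) g * irrChar n (conjFun n (pf γ)) g) := by
    intro g
    rw [permChar_eq_sum l hl, permChar_eq_sum m hm, permChar_eq_sum ν hν, mul_assoc,
      Finset.sum_mul_sum, Finset.sum_mul_sum]
    simp only [Finset.mul_sum, irrChar_conjFun_pf]
    exact Finset.sum_congr rfl fun α _ => Finset.sum_congr rfl fun β _ =>
      Finset.sum_congr rfl fun γ _ => by ring
  symm
  simp only [h]
  rw [Finset.sum_comm, Finset.sum_div]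
  refine Finset.sum_congr rfl fun α _ => ?_
  rw [Finset.sum_comm, Finset.sum_div]
  refine Finset.sum_congr rfl fun β _ => ?_
  rw [Finset.sum_comm, Finset.sum_div]
  refine Finset.sum_congr rfl fun γ _ => ?_
  rw [kron, innerChar, ← mul_div_assoc, Finset.mul_sum]

end BinaryMatrixCount

/-- `m*(l,m,ν) = ∑_{α,β,γ ⊢ n} K_{αl} K_{βm} K_{γν} k(α,β,γ')`. -/
theorem stmt7 (n p q r : ℕ) (l : Fin p → ℕ) (m : Fin q → ℕ) (ν : Fin r → ℕ)
    (hl : ∑ i, l i = n) (hm : ∑ j, m j = n) (hν : ∑ k, ν k = n) :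
    (Nat.card {A : Fin p → Fin q → Fin r → ℕ // (∀ i j k, A i j k ≤ 1) ∧
        (∀ i, ∑ j, ∑ k, A i j k = l i) ∧ (∀ j, ∑ i, ∑ k, A i j k = m j) ∧
        (∀ k, ∑ i, ∑ j, A i j k = ν k)} : ℚ) =
      ∑ α : n.Partition, ∑ β : n.Partition, ∑ γ : n.Partition,
        (kostka (pf α) (extc l) : ℚ) * (kostka (pf β) (extc m) : ℚ) *
          (kostka (pf γ) (extc ν) : ℚ) * kron n (pf α) (pf β) (conjFun n (pf γ)) := by
  rw [BinaryMatrixCount.sum_partitions_eq l m ν hl hm hν,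
    BinaryMatrixCount.sum_sign_mul_permChar, BinaryMatrixCount.card_injective_eq l m ν hl,
    BinaryMatrixCount.card_matrices]
  push_cast
  rw [mul_div_cancel_right₀ _ (Nat.cast_ne_zero.2 n.factorial_ne_zero)]
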